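/- arXiv:2512.23193 — 9 statements merged into one kernel-verified Lean document; each statement's English description precedes it below -/
import Mathlib

section
/- Let G be a finite directed graph on vertex set N = {1,…,n} with adjacency function g : N × N → {0,1}, g_ii = 0. Let b : ℝ → ℝ be differentiable, strictly increasing and strictly concave with b(0) = 0, let c > 0 satisfy b'(0) > c, and let e* > 0 be the unique value with b'(e*) = c. In the game where each player i chooses e_i ≥ 0 and receives payoff U_i(e) = b(e_i + Σ_j g_ij e_j) − c·e_i, a profile e with e_i ∈ {0, e*} for every i is a Nash equilibrium if and only if the set K = {i : e_i = e*} of specialists is a kernel of G. -/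
/-- `K` is a kernel of the digraph on `Fin n` with adjacency `g`:
`K` is independent and every vertex outside `K` has an out-edge into `K`. -/
def IsKernel {n : ℕ} (g : Fin n → Fin n → ℝ) (K : Set (Fin n)) : Prop :=
  (∀ i ∈ K, ∀ j ∈ K, g i j = 0) ∧ ∀ i ∉ K, ∃ j ∈ K, g i j = 1

/-- Payoff of player `i` in the public goods game on the digraph `g`:
`U_i(e) = b (e_i + ∑_j g_ij e_j) - c e_i`. -/
def payoff {n : ℕ} (b : ℝ → ℝ) (c : ℝ) (g : Fin n → Fin n → ℝ)
    (e : Fin n → ℝ) (i : Fin n) : ℝ :=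
  b (e i + ∑ j, g i j * e j) - c * e i

/-- `e` is a Nash equilibrium of the public goods game: every `e_i` is a feasible
(nonnegative) action and no player can profit from a unilateral deviation to
another feasible action. -/
def IsNash {n : ℕ} (b : ℝ → ℝ) (c : ℝ) (g : Fin n → Fin n → ℝ)
    (e : Fin n → ℝ) : Prop :=
  (∀ i, 0 ≤ e i) ∧
    ∀ i, ∀ x : ℝ, 0 ≤ x →
      payoff b c g (Function.update e i x) i ≤ payoff b c g e i

/-- A differentiable strictly concave function lies strictly below its tangent lines. -/
theorem StrictConcaveOn.lt_tangent {b : ℝ → ℝ} (hb : StrictConcaveOn ℝ Set.univ b)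
    {x y : ℝ} (hd : DifferentiableAt ℝ b x) (hxy : x ≠ y) :
    b y < b x + deriv b x * (y - x) := by
  rcases lt_or_gt_of_ne hxy with h | h
  · have hs := hb.slope_lt_of_hasDerivAt (Set.mem_univ x) (Set.mem_univ y) h hd.hasDerivAt
    rw [slope_def_field, div_lt_iff₀ (sub_pos.2 h)] at hs
    linarith
  · have hs := hb.lt_slope_of_hasDerivAt (Set.mem_univ y) (Set.mem_univ x) h hd.hasDerivAt
    rw [slope_def_field, lt_div_iff₀ (sub_pos.2 h)] at hs
    linarith

/-- To the right of the threshold `x`, a strictly concave function grows more slowly than its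
tangent at `x`. -/
theorem StrictConcaveOn.sub_lt_deriv_mul_sub {b : ℝ → ℝ} (hb : StrictConcaveOn ℝ Set.univ b)
    (hd : Differentiable ℝ b) {x s t : ℝ} (hxs : x ≤ s) (hst : s < t) :
    b t - b s < deriv b x * (t - s) := by
  have hderiv : deriv b s ≤ deriv b x := by
    rcases hxs.eq_or_lt with rfl | h
    · exact le_rfl
    · have h₁ := hb.lt_tangent (hd x) h.ne
      have h₂ := hb.lt_tangent (hd s) h.ne'
      by_contra! h₃
      nlinarith
  have ht := hb.lt_tangent (hd s) hst.ne
  nlinarith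

theorem payoff_update {n : ℕ} {b : ℝ → ℝ} {c : ℝ} {g : Fin n → Fin n → ℝ}
    {e : Fin n → ℝ} {i : Fin n} (hgi : g i i = 0) (x : ℝ) :
    payoff b c g (Function.update e i x) i = b (x + ∑ j, g i j * e j) - c * x := by
  have hsum : ∑ j, g i j * Function.update e i x j = ∑ j, g i j * e j := by
    refine Finset.sum_congr rfl fun j _ => ?_
    rcases eq_or_ne j i with rfl | h
    · simp [hgi]
    · simp [h]
  simp [payoff, hsum]

/-- Kernel and specialized equilibrium.
For a digraph `g` on `Fin n` (entries in `{0,1}`, zero diagonal), a differentiable,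
strictly increasing and strictly concave benefit function `b` with `b 0 = 0`, marginal
cost `c > 0` with `b' 0 > c`, and threshold `e* > 0` with `b' e* = c`:
a profile `e` with `e i ∈ {0, e*}` for all `i` is a Nash equilibrium iff its set of
specialists `{i | e i = e*}` is a kernel of `g`. -/
theorem specialized_profile_nash_iff_kernel
    {n : ℕ} (g : Fin n → Fin n → ℝ)
    (hg01 : ∀ i j, g i j = 0 ∨ g i j = 1) (hgdiag : ∀ i, g i i = 0)
    (b : ℝ → ℝ) (c estar : ℝ)
    (hbdiff : Differentiable ℝ b)
    (hbmono : StrictMono b)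
    (hbconc : StrictConcaveOn ℝ Set.univ b)
    (hb0 : b 0 = 0)
    (hc : 0 < c)
    (hslope0 : c < deriv b 0)
    (hestar : 0 < estar)
    (hslope : deriv b estar = c)
    (e : Fin n → ℝ) (he : ∀ i, e i = 0 ∨ e i = estar) :
    IsNash b c g e ↔ IsKernel g {i | e i = estar} := by
  have hnonneg : ∀ i, 0 ≤ e i := fun i => by rcases he i with h | h <;> simp [h, hestar.le]
  have hterm : ∀ i j, 0 ≤ g i j * e j := fun i j =>
    mul_nonneg (by rcases hg01 i j with h | h <;> simp [h]) (hnonneg j)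
  have hsum : ∀ i j, g i j = 1 → e j = estar → estar ≤ ∑ k, g i k * e k := fun i j hg hj => by
    simpa [hg, hj] using
      Finset.single_le_sum (fun k _ => hterm i k) (Finset.mem_univ j)
  have hsum_zero : ∀ i, (∀ j, e j = estar → g i j = 0) → ∑ k, g i k * e k = 0 := fun i h =>
    Finset.sum_eq_zero fun j _ => by
      rcases he j with hj | hj
      · simp [hj]
      · simp [h j hj]
  constructor
  · rintro ⟨-, hN⟩
    refine ⟨fun i hi j hj => (hg01 i j).resolve_right fun hg => ?_, fun i hi => ?_⟩
    · have hi : e i = estar := hi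
      have hdev := hN i 0 le_rfl
      have hlt := hbconc.sub_lt_deriv_mul_sub hbdiff (hsum i j hg hj)
        (lt_add_of_pos_left (∑ k, g i k * e k) hestar)
      rw [payoff_update (hgdiag i), payoff, hi] at hdev
      simp only [zero_add, hslope] at hdev hlt
      linarith
    · have hi : e i = 0 := (he i).resolve_right hi
      by_contra! hK
      have hs := hsum_zero i fun j hj => (hg01 i j).resolve_right (hK j hj)
      have hdev := hN i estar hestar.le
      have hlt := hbconc.lt_tangent (hbdiff estar) hestar.ne'
      rw [payoff_update (hgdiag i), payoff, hs, hi] at hdev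
      simp only [add_zero, hslope] at hdev hlt
      linarith
  · rintro ⟨hind, habs⟩
    refine ⟨hnonneg, fun i x hx => ?_⟩
    rw [payoff_update (hgdiag i), payoff]
    by_cases hi : e i = estar
    · rw [hsum_zero i fun j hj => hind i hi j hj, hi, add_zero, add_zero]
      rcases eq_or_ne estar x with rfl | hne
      · exact le_rfl
      · have hlt := hbconc.lt_tangent (hbdiff estar) hne
        rw [hslope] at hlt
        linarith
    · obtain ⟨j, hj, hg⟩ := habs i hi
      rw [(he i).resolve_right hi]
      rcases hx.eq_or_lt with rfl | hpos
      · exact le_rfl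
      · have hlt := hbconc.sub_lt_deriv_mul_sub hbdiff (hsum i j hg hj)
          (lt_add_of_pos_left (∑ k, g i k * e k) hpos)
        rw [hslope] at hlt
        rw [zero_add]
        linarith
end

section
/- Every finite directed graph that contains no directed cycle of odd length has a kernel. Consequently, in the public goods game on such a digraph a specialized equilibrium always exists. -/
/-- `v : Fin k → Fin n` is a directed cycle of length `k ≥ 1` in `g`:
distinct vertices `v 0, …, v (k-1)` with an edge from each `v i` to `v (i+1)`
(indices mod `k`). -/
def IsDirCycle {n : ℕ} (g : Fin n → Fin n → ℝ) (k : ℕ) (v : Fin k → Fin n) : Prop :=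
  0 < k ∧ Function.Injective v ∧
    ∀ i : Fin k, g (v i) (v ⟨(i.1 + 1) % k, Nat.mod_lt _ i.pos⟩) = 1

/-- `e` is a specialized equilibrium of the public goods game on `g` with
threshold `e* > 0`: each player contributes `0` when the spillovers received
reach `e*`, and contributes `e*` otherwise. -/
def IsSpecEq {n : ℕ} (g : Fin n → Fin n → ℝ) (estar : ℝ) (e : Fin n → ℝ) : Prop :=
  ∀ i, (estar ≤ ∑ j, g i j * e j → e i = 0) ∧ (∑ j, g i j * e j < estar → e i = estar)

/-- There is a walk of length `k` from `x` to `y` along the relation `R`. -/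
inductive WalkOfLength {V : Type*} (R : V → V → Prop) : ℕ → V → V → Prop
  | nil (x : V) : WalkOfLength R 0 x x
  | cons {k : ℕ} {x y z : V} : R x y → WalkOfLength R k y z → WalkOfLength R (k + 1) x z

namespace WalkOfLength

variable {V : Type*} {R : V → V → Prop}

theorem append {k l : ℕ} {x y z : V} (h : WalkOfLength R k x y) (h' : WalkOfLength R l y z) :
    WalkOfLength R (k + l) x z := by
  induction h with
  | nil => simpa using h'
  | cons hr _ ih => rw [Nat.add_right_comm]; exact cons hr (ih h')

theorem mono {R' : V → V → Prop} (hR : ∀ a b, R a b → R' a b) {k : ℕ} {x y : V}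
    (h : WalkOfLength R k x y) : WalkOfLength R' k x y := by
  induction h with
  | nil x => exact nil x
  | cons hr _ ih => exact cons (hR _ _ hr) ih

theorem exists_fun {k : ℕ} {x y : V} (h : WalkOfLength R k x y) :
    ∃ f : ℕ → V, f 0 = x ∧ f k = y ∧ ∀ i < k, R (f i) (f (i + 1)) := by
  induction h with
  | nil x => exact ⟨fun _ => x, rfl, rfl, by simp⟩
  | @cons k x y z hr _ ih =>
    obtain ⟨f, h0, hk, hf⟩ := ih
    refine ⟨fun m => Nat.casesOn m x f, rfl, hk, ?_⟩
    rintro (_ | i) hi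
    · simpa [h0] using hr
    · exact hf i (by omega)

end WalkOfLength

/-- An odd closed walk contains an odd cycle. -/
theorem exists_odd_cycle_of_odd_closed_walk {V : Type*} {R : V → V → Prop} (k : ℕ) (f : ℕ → V)
    (hk : Odd k) (hclosed : f 0 = f k) (hf : ∀ i < k, R (f i) (f (i + 1))) :
    ∃ (l : ℕ) (c : ℕ → V), Odd l ∧ c 0 = c l ∧ (∀ i < l, R (c i) (c (i + 1))) ∧
      ∀ i j, i < j → j < l → c i ≠ c j := by
  induction k using Nat.strong_induction_on generalizing f with
  | _ k ih =>
  by_cases hinj : ∀ i j, i < j → j < k → f i ≠ f j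
  · exact ⟨k, f, hk, hclosed, hf, hinj⟩
  push Not at hinj
  obtain ⟨i, j, hij, hjk, hfij⟩ := hinj
  by_cases hodd : Odd (j - i)
  · refine ih (j - i) (by omega) (fun m => f (i + m)) hodd ?_ ?_
    · simpa [Nat.add_sub_cancel' hij.le] using hfij
    · intro m hm
      exact hf (i + m) (by omega)
  · refine ih (k - (j - i)) (by omega) (fun m => if m ≤ i then f m else f (m + (j - i))) ?_ ?_ ?_
    · rw [Nat.odd_iff] at *
      omega
    · have hlt : ¬ k - (j - i) ≤ i := by omega
      have hadd : k - (j - i) + (j - i) = k := by omega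
      simpa [hlt, hadd] using hclosed
    · intro m hm
      rcases lt_trichotomy m i with h | rfl | h
      · simpa [h.le, Nat.succ_le_of_lt h] using hf m (by omega)
      · have hadd : m + 1 + (j - m) = j + 1 := by omega
        simpa [hadd, hfij] using hf j hjk
      · have h1 : ¬ m ≤ i := by omega
        have h2 : ¬ m + 1 ≤ i := by omega
        have hadd : m + 1 + (j - i) = m + (j - i) + 1 := by omega
        simpa [h1, h2, hadd] using hf (m + (j - i)) (by omega)

/-- A finite nonempty set contains a vertex lying in a terminal strong component of a relation. -/
theorem exists_terminal_vertex {V : Type*} [Finite V] (R : V → V → Prop) {S : Set V}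
    (hS : S.Nonempty) (hclosed : ∀ a b, R a b → b ∈ S) :
    ∃ x ∈ S, ∀ k y, WalkOfLength R k x y → ∃ l, WalkOfLength R l y x := by
  let reach : V → Set V := fun x => {y | ∃ k, WalkOfLength R k x y}
  obtain ⟨x, hx, hmin⟩ := S.exists_min_image (fun x => (reach x).ncard) S.toFinite hS
  refine ⟨x, hx, fun k y hxy => ?_⟩
  have hy : y ∈ S := by
    clear hmin
    induction hxy with
    | nil => exact hx
    | cons hr _ ih => exact ih (hclosed _ _ hr)
  have hsub : reach y ⊆ reach x := fun z ⟨l, hl⟩ => ⟨k + l, hxy.append hl⟩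
  have heq : reach y = reach x := Set.eq_of_subset_of_ncard_le hsub (hmin y hy) (Set.toFinite _)
  have hmem : x ∈ reach x := ⟨0, .nil x⟩
  rwa [← heq] at hmem

/-- Richardson's theorem for subsets of a finite vertex set: if every closed walk is even, every
induced subgraph has a kernel. -/
theorem exists_kernel_on_of_no_odd_closed_walk {V : Type*} [Finite V] (R : V → V → Prop)
    (hR : ∀ k x, WalkOfLength R k x x → Even k) (S : Set V) :
    ∃ K ⊆ S, (∀ i ∈ K, ∀ j ∈ K, ¬ R i j) ∧ ∀ i ∈ S, i ∉ K → ∃ j ∈ K, R i j := by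
  induction S using WellFoundedLT.induction with
  | _ S ih =>
  rcases S.eq_empty_or_nonempty with rfl | hS
  · exact ⟨∅, by simp⟩
  let RS : V → V → Prop := fun a b => a ∈ S ∧ b ∈ S ∧ R a b
  have hsingle : ∀ {a b}, RS a b → WalkOfLength RS 1 a b := fun h => .cons h (.nil _)
  have hmem : ∀ {k x y}, WalkOfLength RS k x y → x ∈ S → y ∈ S := by
    intro k x y h hx
    induction h with
    | nil => exact hx
    | cons hr _ ih => exact ih hr.2.1
  have hcycle : ∀ {k l x y}, WalkOfLength RS k x y → WalkOfLength RS l y x → Even (k + l) :=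
    fun h h' => hR _ _ ((h.append h').mono fun _ _ h => h.2.2)
  obtain ⟨x, hx, hterm⟩ := exists_terminal_vertex RS hS fun _ _ h => h.2.1
  let K₀ : Set V := {y | ∃ k, Even k ∧ WalkOfLength RS k x y}
  have hxK₀ : x ∈ K₀ := ⟨0, Even.zero, .nil x⟩
  have hK₀S : K₀ ⊆ S := fun y ⟨_, _, h⟩ => hmem h hx
  have habs : ∀ k y, WalkOfLength RS k x y → y ∉ K₀ → ∃ z ∈ K₀, R y z := by
    intro k y hxy hy
    have hk : ¬ Even k := fun hk => hy ⟨k, hk, hxy⟩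
    obtain ⟨l, hyx⟩ := hterm k y hxy
    cases hyx with
    | nil => exact absurd hxK₀ hy
    | cons hr _ =>
      exact ⟨_, ⟨k + 1, by rwa [Nat.even_add_one], hxy.append (hsingle hr)⟩, hr.2.2⟩
  let T : Set V := {y ∈ S | y ∉ K₀ ∧ ∀ z ∈ K₀, ¬ R y z}
  have hTS : T < S := Set.ssubset_iff_of_subset (fun y h => h.1) |>.2 ⟨x, hx, fun h => h.2.1 hxK₀⟩
  obtain ⟨K, hKT, hind, hdom⟩ := ih T hTS
  refine ⟨K₀ ∪ K, Set.union_subset hK₀S (hKT.trans hTS.subset), ?_, ?_⟩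
  · rintro i (hi | hi) j (hj | hj) hij
    · obtain ⟨k, hk, hxi⟩ := hi
      obtain ⟨l, hl, hxj⟩ := hj
      have hr : RS i j := ⟨hmem hxi hx, hmem hxj hx, hij⟩
      obtain ⟨m, hjx⟩ := hterm l j hxj
      have h1 := hcycle hxj hjx
      have h2 := hcycle (hxi.append (hsingle hr)) hjx
      rw [Nat.even_iff] at *
      omega
    · obtain ⟨k, -, hxi⟩ := hi
      have hjT := hKT hj
      obtain ⟨z, hz, hjz⟩ :=
        habs _ j (hxi.append (hsingle ⟨hmem hxi hx, hjT.1, hij⟩)) hjT.2.1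
      exact hjT.2.2 z hz hjz
    · exact (hKT hi).2.2 j hj hij
    · exact hind i hi j hj hij
  · intro i hi hiK
    rw [Set.mem_union, not_or] at hiK
    by_cases hiT : i ∈ T
    · obtain ⟨j, hj, hij⟩ := hdom i hiT hiK.2
      exact ⟨j, .inr hj, hij⟩
    · have : ∃ z ∈ K₀, R i z := by
        by_contra! hno
        exact hiT ⟨hi, hiK.1, hno⟩
      obtain ⟨z, hz, hiz⟩ := this
      exact ⟨z, .inl hz, hiz⟩

/-- A digraph without directed cycles of odd length has only even closed walks. -/
theorem even_of_closed_walk {n : ℕ} (g : Fin n → Fin n → ℝ)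
    (hnoodd : ∀ (k : ℕ) (v : Fin k → Fin n), IsDirCycle g k v → ¬ Odd k)
    (k : ℕ) (x : Fin n) (h : WalkOfLength (fun i j => g i j = 1) k x x) : Even k := by
  by_contra hk
  obtain ⟨f, h0, hfk, hf⟩ := h.exists_fun
  obtain ⟨l, c, hl, hc, hstep, hinj⟩ := exists_odd_cycle_of_odd_closed_walk
    (R := fun i j => g i j = 1) k f
    (Nat.not_even_iff_odd.1 hk) (h0.trans hfk.symm) hf
  refine hnoodd l (fun i => c i) ⟨hl.pos, ?_, ?_⟩ hl
  · intro i j hij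
    rcases lt_trichotomy i j with hlt | heq | hlt
    · exact absurd hij (hinj i j hlt j.2)
    · exact heq
    · exact absurd hij.symm (hinj j i hlt i.2)
  · intro i
    have hi := hstep i i.2
    rcases Nat.lt_or_ge (i + 1) l with hlt | hge
    · simpa [Nat.mod_eq_of_lt hlt] using hi
    · have heq : (i : ℕ) + 1 = l := by omega
      simpa [heq, hc] using hi

/-- A kernel gives a specialized equilibrium, with its vertices as the specialists. -/
theorem IsKernel.exists_isSpecEq {n : ℕ} {g : Fin n → Fin n → ℝ} {K : Set (Fin n)}
    (hK : IsKernel g K) (hg : ∀ i j, 0 ≤ g i j) {estar : ℝ} (hestar : 0 < estar) :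
    ∃ e : Fin n → ℝ, IsSpecEq g estar e := by
  classical
  refine ⟨fun i => if i ∈ K then estar else 0, fun i => ?_⟩
  by_cases hi : i ∈ K
  · have hsum : ∑ j, g i j * (if j ∈ K then estar else 0) = 0 := by
      refine Finset.sum_eq_zero fun j _ => ?_
      by_cases hj : j ∈ K
      · simp [hK.1 i hi j hj]
      · simp [hj]
    simp only [hsum, hi, if_true]
    exact ⟨fun h => absurd h hestar.not_ge, fun _ => trivial⟩
  · obtain ⟨j, hj, hij⟩ := hK.2 i hi
    have hsum : estar ≤ ∑ j, g i j * (if j ∈ K then estar else 0) := by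
      calc estar = g i j * (if j ∈ K then estar else 0) := by simp [hij, hj]
        _ ≤ _ := Finset.single_le_sum (f := fun j => g i j * (if j ∈ K then estar else 0))
          (fun m _ => mul_nonneg (hg i m) (by split_ifs <;> simp [hestar.le])) (Finset.mem_univ j)
    exact ⟨fun _ => by simp [hi], fun h => absurd h hsum.not_gt⟩

/-- Richardson. Every finite digraph with no directed cycle of odd
length has a kernel; consequently the public goods game on such a digraph has a
specialized equilibrium. -/
theorem kernel_exists_of_no_odd_cycle
    {n : ℕ} (g : Fin n → Fin n → ℝ)
    (hg01 : ∀ i j, g i j = 0 ∨ g i j = 1) (hgdiag : ∀ i, g i i = 0)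
    (hnoodd : ∀ (k : ℕ) (v : Fin k → Fin n), IsDirCycle g k v → ¬ Odd k)
    (estar : ℝ) (hestar : 0 < estar) :
    (∃ K : Set (Fin n), IsKernel g K) ∧ (∃ e : Fin n → ℝ, IsSpecEq g estar e) := by
  obtain ⟨K, -, hind, hdom⟩ := exists_kernel_on_of_no_odd_closed_walk (fun i j => g i j = 1)
    (even_of_closed_walk g hnoodd) Set.univ
  have hK : IsKernel g K :=
    ⟨fun i hi j hj => (hg01 i j).resolve_right (hind i hi j hj), fun i => hdom i trivial⟩
  have hg : ∀ i j, 0 ≤ g i j := fun i j => by rcases hg01 i j with h | h <;> simp [h]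
  exact ⟨⟨K, hK⟩, hK.exists_isSpecEq hg hestar⟩
end

section
/- Fix p ∈ [0,1]. For each n, let G(n,p) be the random digraph on vertex set {1,…,n} in which each ordered pair (i,j) with i ≠ j is an edge independently with probability p. Then the probability that G(n,p) contains a kernel tends to 1 as n → ∞. -/
/-- Ordered pairs of distinct vertices of `Fin n`: the potential edges of a digraph. -/
abbrev EdgeIdx (n : ℕ) := {q : Fin n × Fin n // q.1 ≠ q.2}

/-- The digraph determined by an outcome `ω` of the random digraph `G(n,p)`:
there is an edge from `i` to `j` (with `i ≠ j`) exactly when `ω` declares the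
ordered pair `(i,j)` present. -/
noncomputable def gOf (n : ℕ) (ω : EdgeIdx n → Bool) : Fin n → Fin n → ℝ :=
  fun i j => if h : i ≠ j then (if ω ⟨(i, j), h⟩ then 1 else 0) else 0

open Classical in
/-- The probability of the event `A` under the product Bernoulli(`p`) measure on the
indicators of the `n(n-1)` ordered pairs of distinct vertices: each ordered pair is an
edge independently with probability `p`. -/
noncomputable def probRandomDigraph (n : ℕ) (p : ℝ) (A : Set (EdgeIdx n → Bool)) : ℝ :=
  ∑ ω : EdgeIdx n → Bool,
    if ω ∈ A then ∏ q : EdgeIdx n, (if ω q then p else 1 - p) else 0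

/-- The expectation of `F` when the coordinates indexed by `ι` are independent
Bernoulli(`p`) variables. -/
noncomputable def bernoulliExpect {ι : Type*} [Fintype ι] [DecidableEq ι] (p : ℝ)
    (F : (ι → Bool) → ℝ) : ℝ :=
  ∑ x : ι → Bool, (∏ j, if x j then p else 1 - p) * F x

/-- The indicator that no coordinate in `S` is present. -/
def avoidInd {ι : Type*} (S : Finset ι) (x : ι → Bool) : ℝ :=
  if ∀ j ∈ S, x j = false then 1 else 0

lemma bernoulliWeight_nonneg {ι : Type*} [Fintype ι] {p : ℝ} (hp0 : 0 ≤ p) (hp1 : p ≤ 1)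
    (x : ι → Bool) :
    0 ≤ ∏ j, (if x j then p else 1 - p) :=
  Finset.prod_nonneg fun j _ => by split_ifs <;> linarith

section Bernoulli

variable {ι : Type*} [Fintype ι] [DecidableEq ι] {p : ℝ}

lemma avoidInd_mul (S T : Finset ι) (x : ι → Bool) :
    avoidInd S x * avoidInd T x = avoidInd (S ∪ T) x := by
  by_cases hS : ∀ j ∈ S, x j = false
  · by_cases hT : ∀ j ∈ T, x j = false
    · have : ∀ j ∈ S ∪ T, x j = false := fun j hj =>
        (Finset.mem_union.1 hj).elim (hS j) (hT j)
      simp only [avoidInd, if_pos hS, if_pos hT, if_pos this, mul_one]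
    · have : ¬ ∀ j ∈ S ∪ T, x j = false := fun h =>
        hT fun j hj => h j (Finset.mem_union_right _ hj)
      simp only [avoidInd, if_neg hT, if_neg this, mul_zero]
  · have : ¬ ∀ j ∈ S ∪ T, x j = false := fun h =>
      hS fun j hj => h j (Finset.mem_union_left _ hj)
    simp only [avoidInd, if_neg hS, if_neg this, zero_mul]

lemma bernoulliExpect_prod (f : ι → Bool → ℝ) :
    bernoulliExpect p (fun x => ∏ j, f j (x j)) = ∏ j, (p * f j true + (1 - p) * f j false) := by
  unfold bernoulliExpect
  simp_rw [← Finset.prod_mul_distrib]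
  have h := Finset.prod_univ_sum (fun _ : ι => (Finset.univ : Finset Bool))
    (fun j b => (if b then p else 1 - p) * f j b)
  rw [Fintype.piFinset_univ] at h
  rw [← h]
  simp

lemma bernoulliExpect_avoidInd (S : Finset ι) :
    bernoulliExpect p (avoidInd S) = (1 - p) ^ S.card := by
  have h : avoidInd S = fun x : ι → Bool =>
      ∏ j, (fun (j : ι) (b : Bool) => if j ∈ S then (if b then (0 : ℝ) else 1) else 1) j (x j) := by
    funext x
    rw [Finset.prod_ite_mem, Finset.univ_inter]
    unfold avoidInd
    split_ifs with hx
    · exact (Finset.prod_eq_one fun j hj => by simp [hx j hj]).symm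
    · push Not at hx
      obtain ⟨j, hj, hxj⟩ := hx
      exact (Finset.prod_eq_zero hj (by simp [hxj])).symm
  have hpow : (1 - p) ^ S.card = ∏ j, if j ∈ S then 1 - p else 1 := by
    rw [Finset.prod_ite_mem, Finset.univ_inter, Finset.prod_const]
  rw [hpow, h, bernoulliExpect_prod
    (fun (j : ι) (b : Bool) => if j ∈ S then (if b then (0 : ℝ) else 1) else 1)]
  refine Finset.prod_congr rfl fun j _ => ?_
  by_cases hj : j ∈ S <;> simp [hj]

lemma bernoulliExpect_add (F G : (ι → Bool) → ℝ) :
    bernoulliExpect p (fun x => F x + G x) = bernoulliExpect p F + bernoulliExpect p G := by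
  simp [bernoulliExpect, mul_add, Finset.sum_add_distrib]

lemma bernoulliExpect_sub (F G : (ι → Bool) → ℝ) :
    bernoulliExpect p (fun x => F x - G x) = bernoulliExpect p F - bernoulliExpect p G := by
  simp [bernoulliExpect, mul_sub, Finset.sum_sub_distrib]

lemma bernoulliExpect_one : bernoulliExpect p (fun _ : ι → Bool => 1) = 1 := by
  simpa using bernoulliExpect_prod (p := p) (fun (_ : ι) (_ : Bool) => (1 : ℝ))

lemma bernoulliExpect_sum {α : Type*} (s : Finset α) (F : α → (ι → Bool) → ℝ) :
    bernoulliExpect p (fun x => ∑ a ∈ s, F a x) = ∑ a ∈ s, bernoulliExpect p (F a) := by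
  unfold bernoulliExpect
  simp_rw [Finset.mul_sum]
  exact Finset.sum_comm

lemma bernoulliExpect_mono (hp0 : 0 ≤ p) (hp1 : p ≤ 1) {F G : (ι → Bool) → ℝ}
    (h : ∀ x, F x ≤ G x) : bernoulliExpect p F ≤ bernoulliExpect p G :=
  Finset.sum_le_sum fun x _ => mul_le_mul_of_nonneg_left (h x) (bernoulliWeight_nonneg hp0 hp1 x)

/-- The second moment method: a variable that vanishes off an event bounds its probability. -/
lemma bernoulliExpect_sq_le (hp0 : 0 ≤ p) (hp1 : p ≤ 1) {F G : (ι → Bool) → ℝ}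
    (hG : ∀ x, G x ^ 2 = G x) (hFG : ∀ x, F x * G x = F x) :
    bernoulliExpect p F ^ 2 ≤ bernoulliExpect p G * bernoulliExpect p (fun x => F x ^ 2) := by
  unfold bernoulliExpect
  refine Finset.sum_sq_le_sum_mul_sum_of_sq_le_mul _ (fun x _ => ?_) (fun x _ => ?_) fun x _ => ?_
  · have := bernoulliWeight_nonneg hp0 hp1 x
    rw [← hG]; positivity
  · have := bernoulliWeight_nonneg hp0 hp1 x
    positivity
  · refine le_of_eq ?_
    linear_combination (-(∏ j, if x j then p else 1 - p) ^ 2 * F x) * hFG x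

end Bernoulli

lemma bernoulliExpect_prod_sigma {n : ℕ} {p : ℝ} {κ : Fin n → Type*} [∀ i, Fintype (κ i)]
    [∀ i, DecidableEq (κ i)] {ι : Type*} [Fintype ι] [DecidableEq ι]
    (e : ι ≃ (Σ i, κ i)) (F : ∀ i, (κ i → Bool) → ℝ) :
    bernoulliExpect p (fun x : ι → Bool => ∏ i, F i (fun j => x (e.symm ⟨i, j⟩))) =
      ∏ i, bernoulliExpect p (F i) := by
  unfold bernoulliExpect
  have h := Finset.prod_univ_sum (fun i : Fin n => (Finset.univ : Finset (κ i → Bool)))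
    (fun i x => (∏ j, if x j then p else 1 - p) * F i x)
  rw [Fintype.piFinset_univ] at h
  rw [h]
  refine Fintype.sum_equiv ((Equiv.arrowCongr e (Equiv.refl Bool)).trans
    (Equiv.piCurry fun (i : Fin n) (_ : κ i) => Bool)) _ _ fun x => ?_
  rw [Finset.prod_mul_distrib]
  congr 1
  rw [← Fintype.prod_sigma', ← e.symm.prod_comp]
  rfl

/-- The edges of the complete digraph, sorted by their tails. -/
def edgeEquiv (n : ℕ) : EdgeIdx n ≃ (Σ i : Fin n, {j : Fin n // i ≠ j}) where
  toFun q := ⟨q.1.1, q.1.2, q.2⟩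
  invFun s := ⟨(s.1, s.2.1), s.2.2⟩
  left_inv _ := rfl
  right_inv _ := rfl

open Classical in
/-- The indicator that `K` is a kernel. -/
noncomputable def kernelInd {n : ℕ} (K : Finset (Fin n)) (ω : EdgeIdx n → Bool) : ℝ :=
  if IsKernel (gOf n ω) (K : Set (Fin n)) then 1 else 0

/-- The possible edges from `i` into `K`. -/
def rowSet {n : ℕ} (K : Finset (Fin n)) (i : Fin n) : Finset {j : Fin n // i ≠ j} :=
  K.subtype fun j => i ≠ j

/-- The indicator that the out-neighbourhood `x` of `i` does not prevent `K` from being a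
kernel. -/
noncomputable def rowInd {n : ℕ} (K : Finset (Fin n)) (i : Fin n)
    (x : {j : Fin n // i ≠ j} → Bool) : ℝ :=
  if i ∈ K then avoidInd (rowSet K i) x else 1 - avoidInd (rowSet K i) x

section Kernel

variable {n : ℕ} {p : ℝ} {K L : Finset (Fin n)} {i : Fin n}

lemma card_rowSet : (rowSet K i).card = (K.erase i).card := by
  rw [rowSet, Finset.card_subtype]
  congr 1
  ext j
  simp [and_comm, eq_comm]

lemma rowSet_union : rowSet K i ∪ rowSet L i = rowSet (K ∪ L) i := by
  ext j
  simp [rowSet]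

lemma isKernel_gOf_iff (ω : EdgeIdx n → Bool) :
    IsKernel (gOf n ω) (K : Set (Fin n)) ↔
      ∀ i, i ∈ K ↔ ∀ j ∈ rowSet K i, ω ((edgeEquiv n).symm ⟨i, j⟩) = false := by
  simp only [IsKernel, gOf, rowSet, Finset.mem_coe, edgeEquiv, Equiv.coe_fn_symm_mk,
    Finset.mem_subtype, Subtype.forall]
  constructor
  · rintro ⟨h₁, h₂⟩ i
    refine ⟨fun hi j hij hj => ?_, fun h => ?_⟩
    · simpa [hij] using h₁ i hi j hj
    · by_contra hi
      obtain ⟨j, hj, hij⟩ := h₂ i hi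
      have hne : i ≠ j := fun h => hi (h ▸ hj)
      simp [hne, h j hne hj] at hij
  · refine fun h => ⟨fun i hi j hj => ?_, fun i hi => ?_⟩
    · by_cases hij : i = j
      · simp [hij]
      · simp [hij, (h i).1 hi j hij hj]
    · have := mt (h i).2 hi
      push Not at this
      obtain ⟨j, hij, hj, hω⟩ := this
      exact ⟨j, hj, by simpa [hij] using hω⟩

lemma kernelInd_eq_prod (ω : EdgeIdx n → Bool) :
    kernelInd K ω = ∏ i, rowInd K i fun j => ω ((edgeEquiv n).symm ⟨i, j⟩) := by
  unfold kernelInd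
  rw [isKernel_gOf_iff]
  split_ifs with h
  · refine (Finset.prod_eq_one fun i _ => ?_).symm
    unfold rowInd avoidInd
    by_cases hi : i ∈ K
    · rw [if_pos hi, if_pos ((h i).1 hi)]
    · rw [if_neg hi, if_neg (mt (h i).2 hi), sub_zero]
  · push Not at h
    obtain ⟨i, hi⟩ := h
    refine (Finset.prod_eq_zero (Finset.mem_univ i) ?_).symm
    unfold rowInd avoidInd
    rcases hi with ⟨hi, hx⟩ | ⟨hi, hx⟩
    · rw [if_pos hi, if_neg]
      push Not
      exact hx
    · rw [if_neg hi, if_pos hx, sub_self]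

lemma bernoulliExpect_kernelInd :
    bernoulliExpect p (kernelInd K) =
      ((1 - p) ^ (K.card - 1)) ^ K.card * (1 - (1 - p) ^ K.card) ^ (n - K.card) := by
  have h : kernelInd K = fun ω : EdgeIdx n → Bool =>
      ∏ i, rowInd K i fun j => ω ((edgeEquiv n).symm ⟨i, j⟩) := funext kernelInd_eq_prod
  have hrow : ∀ i, bernoulliExpect p (rowInd K i) =
      if i ∈ K then (1 - p) ^ (K.card - 1) else 1 - (1 - p) ^ K.card := by
    intro i
    by_cases hi : i ∈ K
    · have : rowInd K i = avoidInd (rowSet K i) := by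
        funext x; simp [rowInd, hi]
      rw [this, bernoulliExpect_avoidInd, card_rowSet, Finset.card_erase_of_mem hi, if_pos hi]
    · have : rowInd K i = fun x => 1 - avoidInd (rowSet K i) x := by
        funext x; simp [rowInd, hi]
      rw [this, bernoulliExpect_sub (fun _ => 1) (avoidInd (rowSet K i)), bernoulliExpect_one,
        bernoulliExpect_avoidInd, card_rowSet, Finset.erase_eq_of_notMem hi, if_neg hi]
  rw [h, bernoulliExpect_prod_sigma (edgeEquiv n) (rowInd K)]
  simp_rw [hrow]
  rw [Finset.prod_ite, Finset.prod_const, Finset.prod_const]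
  have h1 : Finset.univ.filter (fun i => i ∈ K) = K := by ext; simp
  have h2 : Finset.univ.filter (fun i => i ∉ K) = Kᶜ := by ext; simp
  rw [h1, h2, Finset.card_compl, Fintype.card_fin]

/-- An upper bound for the probability that two `k`-sets meeting in `l` vertices are both
kernels. -/
lemma bernoulliExpect_kernelInd_mul_le (hp0 : 0 ≤ p) (hp1 : p ≤ 1) {k l : ℕ}
    (hK : K.card = k) (hL : L.card = k) (hl : (K ∩ L).card = l) :
    bernoulliExpect p (fun ω => kernelInd K ω * kernelInd L ω) ≤
      ((1 - p) ^ (2 * k - l - 1)) ^ l *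
        ((1 - p) ^ (k - 1) * (1 - (1 - p) ^ k)) ^ (2 * (k - l)) *
        (1 - 2 * (1 - p) ^ k + (1 - p) ^ (2 * k - l)) ^ (n - (2 * k - l)) := by
  have hq0 : 0 ≤ 1 - p := by linarith
  have hq1 : 1 - p ≤ 1 := by linarith
  have hU : (K ∪ L).card = 2 * k - l := by
    have := Finset.card_union_add_card_inter K L
    omega
  have hKL : (K \ L).card = k - l := by
    have := Finset.card_sdiff_add_card_inter K L
    omega
  have hLK : (L \ K).card = k - l := by
    have := Finset.card_sdiff_add_card_inter L K
    rw [Finset.inter_comm] at this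
    omega
  have hlk : l ≤ k := by
    rw [← hl, ← hK]; exact Finset.card_le_card Finset.inter_subset_left
  have h : (fun ω : EdgeIdx n → Bool => kernelInd K ω * kernelInd L ω) =
      fun ω => ∏ i, (fun i x => rowInd K i x * rowInd L i x) i
        fun j => ω ((edgeEquiv n).symm ⟨i, j⟩) := by
    funext ω
    rw [kernelInd_eq_prod, kernelInd_eq_prod, Finset.prod_mul_distrib]
  have hone : ∀ (A B : Finset (Fin n)) (i : Fin n), A.card = k → (A ∪ B).card = 2 * k - l →
      i ∈ A → i ∉ B →
      bernoulliExpect p (fun x => rowInd A i x * rowInd B i x) ≤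
        (1 - p) ^ (k - 1) * (1 - (1 - p) ^ k) := by
    intro A B i hA hAB hiA hiB
    have : (fun x => rowInd A i x * rowInd B i x) =
        fun x => avoidInd (rowSet A i) x - avoidInd (rowSet (A ∪ B) i) x := by
      funext x
      rw [rowInd, rowInd, if_pos hiA, if_neg hiB, mul_sub, avoidInd_mul, rowSet_union, mul_one]
    rw [this, bernoulliExpect_sub, bernoulliExpect_avoidInd, bernoulliExpect_avoidInd,
      card_rowSet, card_rowSet, Finset.card_erase_of_mem hiA,
      Finset.card_erase_of_mem (Finset.mem_union_left _ hiA), hA, hAB]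
    have : (1 - p) ^ (k - 1) * (1 - p) ^ k ≤ (1 - p) ^ (2 * k - l - 1) := by
      rw [← pow_add]
      exact pow_le_pow_of_le_one hq0 hq1 (by omega)
    linarith
  have hboth : ∀ i ∈ K ∩ L, bernoulliExpect p (fun x => rowInd K i x * rowInd L i x) =
      (1 - p) ^ (2 * k - l - 1) := by
    intro i hi
    rw [Finset.mem_inter] at hi
    have : (fun x => rowInd K i x * rowInd L i x) = avoidInd (rowSet (K ∪ L) i) := by
      funext x
      rw [rowInd, rowInd, if_pos hi.1, if_pos hi.2, avoidInd_mul, rowSet_union]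
    rw [this, bernoulliExpect_avoidInd, card_rowSet,
      Finset.card_erase_of_mem (Finset.mem_union_left _ hi.1), hU]
  have hnone : ∀ i, i ∉ K → i ∉ L → bernoulliExpect p (fun x => rowInd K i x * rowInd L i x) =
      1 - 2 * (1 - p) ^ k + (1 - p) ^ (2 * k - l) := by
    intro i hiK hiL
    have : (fun x => rowInd K i x * rowInd L i x) =
        fun x => (1 - avoidInd (rowSet K i) x - avoidInd (rowSet L i) x) +
          avoidInd (rowSet (K ∪ L) i) x := by
      funext x
      rw [rowInd, rowInd, if_neg hiK, if_neg hiL, ← rowSet_union, ← avoidInd_mul]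
      ring
    rw [this, bernoulliExpect_add (fun x => 1 - avoidInd (rowSet K i) x - avoidInd (rowSet L i) x),
      bernoulliExpect_sub (fun x => 1 - avoidInd (rowSet K i) x),
      bernoulliExpect_sub (fun _ => 1) (avoidInd (rowSet K i)),
      bernoulliExpect_one, bernoulliExpect_avoidInd, bernoulliExpect_avoidInd,
      bernoulliExpect_avoidInd, card_rowSet, card_rowSet, card_rowSet,
      Finset.erase_eq_of_notMem hiK, Finset.erase_eq_of_notMem hiL,
      Finset.erase_eq_of_notMem (by simp [hiK, hiL]), hK, hL, hU]
    ring
  have hnonneg : ∀ (A B : Finset (Fin n)) (i : Fin n),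
      0 ≤ bernoulliExpect p (fun x => rowInd A i x * rowInd B i x) := by
    intro A B i
    have h0 : bernoulliExpect p (fun _ : {j : Fin n // i ≠ j} → Bool => 0) = 0 := by
      simp [bernoulliExpect]
    rw [← h0]
    have hrow : ∀ (A : Finset (Fin n)) x, 0 ≤ rowInd A i x := by
      intro A x
      unfold rowInd avoidInd
      split_ifs <;> norm_num
    exact bernoulliExpect_mono hp0 hp1 fun x => mul_nonneg (hrow A x) (hrow B x)
  rw [h, bernoulliExpect_prod_sigma (edgeEquiv n) fun i x => rowInd K i x * rowInd L i x]
  have hsplit : ∀ f : Fin n → ℝ, ∏ i, f i =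
      (∏ i ∈ K ∩ L, f i) * ((∏ i ∈ K \ L, f i) * ∏ i ∈ L \ K, f i) * ∏ i ∈ (K ∪ L)ᶜ, f i := by
    intro f
    rw [← Finset.prod_mul_prod_compl (K ∪ L) f]
    congr 1
    rw [← Finset.prod_union (Finset.disjoint_left.2 fun i hi hi' => by simp_all),
      ← Finset.prod_union (Finset.disjoint_left.2 fun i hi hi' => by simp at hi hi'; tauto)]
    congr 1
    ext i
    simp only [Finset.mem_union, Finset.mem_inter, Finset.mem_sdiff]
    tauto
  rw [hsplit, Finset.prod_congr rfl hboth, Finset.prod_const, hl,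
    Finset.prod_congr rfl (fun i hi => hnone i (by simp_all) (by simp_all)) (s₁ := (K ∪ L)ᶜ),
    Finset.prod_const, Finset.card_compl, hU, Fintype.card_fin, two_mul (k - l), pow_add]
  have hD : 0 ≤ 1 - 2 * (1 - p) ^ k + (1 - p) ^ (2 * k - l) := by
    have : (1 - p) ^ k * (1 - p) ^ k ≤ (1 - p) ^ (2 * k - l) := by
      rw [← pow_add]
      exact pow_le_pow_of_le_one hq0 hq1 (by omega)
    nlinarith [sq_nonneg (1 - (1 - p) ^ k)]
  have hle : ∀ A B : Finset (Fin n), A.card = k → (A ∪ B).card = 2 * k - l →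
      (A \ B).card = k - l →
      ∏ i ∈ A \ B, bernoulliExpect p (fun x => rowInd A i x * rowInd B i x) ≤
        ((1 - p) ^ (k - 1) * (1 - (1 - p) ^ k)) ^ (k - l) := by
    intro A B hA hAB hdiff
    rw [← hdiff, ← Finset.prod_const]
    exact Finset.prod_le_prod (fun i _ => hnonneg A B i) fun i hi =>
      hone A B i hA hAB (Finset.mem_sdiff.1 hi).1 (Finset.mem_sdiff.1 hi).2
  have hleKL := hle K L hK hU hKL
  have hleLK := hle L K hL (by rw [Finset.union_comm, hU]) hLK
  simp_rw [mul_comm (rowInd L _ _)] at hleLK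
  gcongr
  · exact Finset.prod_nonneg fun i _ => hnonneg K L i
  · exact pow_nonneg (mul_nonneg (pow_nonneg hq0 _)
      (sub_nonneg.2 (pow_le_one₀ hq0 hq1))) _

end Kernel

/-- The probability that a given set of `k` among `n` vertices is a kernel, `q` being the
probability of a missing edge. -/
noncomputable def kernelProb (q : ℝ) (n k : ℕ) : ℝ := (q ^ (k - 1)) ^ k * (1 - q ^ k) ^ (n - k)

/-- An upper bound for the probability that two given `k`-sets meeting in `l` vertices are both
kernels. -/
noncomputable def pairBound (q : ℝ) (n k l : ℕ) : ℝ :=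
  (q ^ (2 * k - l - 1)) ^ l * (q ^ (k - 1) * (1 - q ^ k)) ^ (2 * (k - l)) *
    (1 - 2 * q ^ k + q ^ (2 * k - l)) ^ (n - (2 * k - l))

section Estimates

variable {q r : ℝ} {n k l : ℕ}

lemma pairBound_mul_eq (hlk : l ≤ k) :
    pairBound q n k l * (q ^ (l - 1)) ^ l = ((q ^ (k - 1)) ^ k) ^ 2 *
      ((1 - q ^ k) ^ (2 * (k - l)) * (1 - 2 * q ^ k + q ^ (2 * k - l)) ^ (n - (2 * k - l))) := by
  have h : (q ^ (2 * k - l - 1)) ^ l * (q ^ (k - 1)) ^ (2 * (k - l)) * (q ^ (l - 1)) ^ l =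
      ((q ^ (k - 1)) ^ k) ^ 2 := by
    rcases l with _ | a
    · simp [← pow_mul, mul_comm 2 k, mul_assoc]
    · obtain ⟨j, rfl⟩ := Nat.exists_eq_add_of_le hlk
      have h1 : 2 * (a + 1 + j) - (a + 1) - 1 = a + 2 * j := by omega
      have h2 : a + 1 + j - 1 = a + j := by omega
      have h3 : a + 1 + j - (a + 1) = j := by omega
      rw [h1, h2, h3, Nat.add_sub_cancel]
      simp only [← pow_mul, ← pow_add]
      congr 1
      ring
  rw [← h, pairBound, mul_pow]
  ring

lemma one_sub_two_mul_add_nonneg (hq0 : 0 ≤ q) (hq1 : q ≤ 1) :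
    0 ≤ 1 - 2 * q ^ k + q ^ (2 * k - l) := by
  have : q ^ k * q ^ k ≤ q ^ (2 * k - l) := by
    rw [← pow_add]
    exact pow_le_pow_of_le_one hq0 hq1 (by omega)
  nlinarith [sq_nonneg (1 - q ^ k)]

lemma kernelProb_nonneg (hq0 : 0 ≤ q) (hq1 : q ≤ 1) : 0 ≤ kernelProb q n k :=
  mul_nonneg (by positivity) (pow_nonneg (sub_nonneg.2 (pow_le_one₀ hq0 hq1)) _)

lemma pairBound_mul_le_sq (hq0 : 0 ≤ q) (hq1 : q ≤ 1) (hlk : l ≤ k) (hkn : 2 * k ≤ n)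
    (hx : q ^ k ≤ 1 / 2) :
    pairBound q n k l * (q ^ (l - 1)) ^ l ≤
      kernelProb q n k ^ 2 * (1 + 4 * q ^ (2 * k - l)) ^ n := by
  have hy : 0 ≤ q ^ (2 * k - l) := by positivity
  have hD := one_sub_two_mul_add_nonneg (k := k) (l := l) hq0 hq1
  have hx1 : 0 ≤ 1 - q ^ k := by linarith
  have hle : 1 - 2 * q ^ k + q ^ (2 * k - l) ≤ (1 - q ^ k) ^ 2 * (1 + 4 * q ^ (2 * k - l)) := by
    have : 1 / 4 ≤ (1 - q ^ k) ^ 2 := by nlinarith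
    nlinarith [sq_nonneg (q ^ k)]
  rw [pairBound_mul_eq hlk, kernelProb, mul_pow, mul_assoc]
  refine mul_le_mul_of_nonneg_left ?_ (by positivity)
  calc (1 - q ^ k) ^ (2 * (k - l)) * (1 - 2 * q ^ k + q ^ (2 * k - l)) ^ (n - (2 * k - l))
      ≤ (1 - q ^ k) ^ (2 * (k - l)) *
          ((1 - q ^ k) ^ 2 * (1 + 4 * q ^ (2 * k - l))) ^ (n - (2 * k - l)) := by gcongr
    _ = ((1 - q ^ k) ^ (n - k)) ^ 2 * (1 + 4 * q ^ (2 * k - l)) ^ (n - (2 * k - l)) := by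
        rw [mul_pow, ← mul_assoc, ← pow_mul, ← pow_add, ← pow_mul]
        congr 2
        omega
    _ ≤ ((1 - q ^ k) ^ (n - k)) ^ 2 * (1 + 4 * q ^ (2 * k - l)) ^ n := by
        gcongr
        · linarith
        · omega

lemma pairBound_mul_le (hq0 : 0 ≤ q) (hq1 : q ≤ 1) (hlk : l ≤ k) (hkn : 2 * k ≤ n) :
    pairBound q n k l * (q ^ (l - 1)) ^ l ≤ kernelProb q n k * (q ^ (k - 1)) ^ k := by
  have hD := one_sub_two_mul_add_nonneg (k := k) (l := l) hq0 hq1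
  have hx0 : 0 ≤ q ^ k := by positivity
  have hx1 : 0 ≤ 1 - q ^ k := sub_nonneg.2 (pow_le_one₀ hq0 hq1)
  have hle : 1 - 2 * q ^ k + q ^ (2 * k - l) ≤ 1 - q ^ k := by
    have : q ^ (2 * k - l) ≤ q ^ k := pow_le_pow_of_le_one hq0 hq1 (by omega)
    linarith
  rw [pairBound_mul_eq hlk, kernelProb, sq, mul_assoc, mul_assoc]
  refine mul_le_mul_of_nonneg_left ?_ (by positivity)
  rw [mul_comm]
  refine mul_le_mul_of_nonneg_right ?_ (by positivity)
  calc (1 - q ^ k) ^ (2 * (k - l)) * (1 - 2 * q ^ k + q ^ (2 * k - l)) ^ (n - (2 * k - l))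
      ≤ (1 - q ^ k) ^ (2 * (k - l)) * (1 - q ^ k) ^ (n - (2 * k - l)) := by gcongr
    _ ≤ (1 - q ^ k) ^ (n - k) := by
        rw [← pow_add]
        exact pow_le_pow_of_le_one hx1 (by linarith) (by omega)

lemma choose_mul_choose_mul_pow_le (hlk : l ≤ k) (hkn : 2 * k ≤ n) :
    ((k.choose l * (n - k).choose (k - l) : ℕ) : ℝ) * ((n : ℝ) / 2) ^ l ≤
      n.choose k * ((k : ℝ) ^ 2) ^ l := by
  have h1 : (n - k).choose (k - l) ≤ (n - l).choose (k - l) := Nat.choose_le_choose _ (by omega)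
  have h2 : n.choose k * k.choose l = n.choose l * (n - l).choose (k - l) :=
    Nat.choose_mul hlk
  have hf : (0 : ℝ) < l.factorial := by positivity
  have h3 : (k.choose l : ℝ) ≤ k ^ l / l.factorial := Nat.choose_le_pow_div l k
  have h4 : ((n : ℝ) / 2) ^ l / l.factorial ≤ n.choose l := by
    refine le_trans ?_ (Nat.pow_le_choose (α := ℝ) l n)
    have : (n : ℝ) / 2 ≤ ((n + 1 - l : ℕ) : ℝ) := by
      rw [div_le_iff₀ two_pos]
      exact_mod_cast (by omega : n ≤ (n + 1 - l) * 2)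
    gcongr
  have h5 : (k.choose l : ℝ) ≤ k ^ l := by exact_mod_cast Nat.choose_le_pow k l
  have h6 : (k.choose l : ℝ) * ((n : ℝ) / 2) ^ l ≤ k ^ l * n.choose l := by
    calc (k.choose l : ℝ) * ((n : ℝ) / 2) ^ l
        ≤ k ^ l / l.factorial * ((n : ℝ) / 2) ^ l := by gcongr
      _ = k ^ l * (((n : ℝ) / 2) ^ l / l.factorial) := by ring
      _ ≤ k ^ l * n.choose l := by gcongr
  have h2' : (n.choose k : ℝ) * k.choose l = n.choose l * (n - l).choose (k - l) := by
    exact_mod_cast h2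
  calc ((k.choose l * (n - k).choose (k - l) : ℕ) : ℝ) * ((n : ℝ) / 2) ^ l
      ≤ ((k.choose l * (n - l).choose (k - l) : ℕ) : ℝ) * ((n : ℝ) / 2) ^ l := by gcongr
    _ = k.choose l * ((n : ℝ) / 2) ^ l * (n - l).choose (k - l) := by push_cast; ring
    _ ≤ k ^ l * n.choose l * (n - l).choose (k - l) := by gcongr
    _ = k ^ l * (n.choose k * k.choose l) := by rw [h2']; ring
    _ ≤ k ^ l * (n.choose k * k ^ l) := by gcongr
    _ = n.choose k * ((k : ℝ) ^ 2) ^ l := by ring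

/-- The contribution of pairs with small overlap to the second moment. -/
lemma choose_mul_pairBound_le_of_small (hr0 : 0 < r) (hr1 : r < 1) (hq : q = r ^ 2) (hk : 2 ≤ k)
    (hkn : 2 * k ≤ n) (hle : n * q ^ k ≤ k) (hge : (k : ℝ) - 1 ≤ n * q ^ (k - 1))
    (hkr : (k : ℝ) ^ 2 * r ^ k ≤ q / 4) (hl : 1 ≤ l) (hlk : 2 * l ≤ k) :
    ((k.choose l * (n - k).choose (k - l) : ℕ) : ℝ) * pairBound q n k l ≤
      n.choose k * kernelProb q n k ^ 2 * (Real.exp 1 * (2 * k ^ 2 * r ^ k)) := by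
  have hq0 : 0 < q := by rw [hq]; positivity
  have hq1 : q ≤ 1 := by rw [hq]; exact pow_le_one₀ hr0.le hr1.le
  have hk' : (2 : ℝ) ≤ k := by exact_mod_cast hk
  have hn : (0 : ℝ) < n := by exact_mod_cast (by omega : 0 < n)
  have hrk : 0 < r ^ k := by positivity
  have hqkl : q ^ (k - l) ≤ r ^ k := by
    rw [hq, ← pow_mul]
    exact pow_le_pow_of_le_one hr0.le hr1.le (by omega)
  have hx : q ^ k ≤ 1 / 2 := by
    have h1 : q ^ k ≤ q ^ (k - l) := pow_le_pow_of_le_one hq0.le hq1 (by omega)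
    nlinarith
  have hexp : (1 + 4 * q ^ (2 * k - l)) ^ n ≤ Real.exp 1 := by
    have h1 : 1 + 4 * q ^ (2 * k - l) ≤ Real.exp (4 * q ^ (2 * k - l)) := by
      linarith [Real.add_one_le_exp (4 * q ^ (2 * k - l))]
    refine (pow_le_pow_left₀ (by positivity) h1 n).trans ?_
    rw [← Real.exp_nat_mul, Real.exp_le_exp]
    have h2 : q ^ (2 * k - l) = q ^ k * q ^ (k - l) := by
      rw [← pow_add]; congr 1; omega
    calc (n : ℝ) * (4 * q ^ (2 * k - l)) = 4 * (n * q ^ k) * q ^ (k - l) := by rw [h2]; ring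
      _ ≤ 4 * k * r ^ k := by gcongr
      _ ≤ 1 := by nlinarith
  have hbase : 2 * (k : ℝ) ^ 2 ≤ 2 * k ^ 2 * r ^ k * (n * q ^ (l - 1)) := by
    have h1 : q ^ (k - 1) = q ^ (l - 1) * q ^ (k - l) := by
      rw [← pow_add]; congr 1; omega
    have h2 : 1 ≤ n * q ^ (l - 1) * r ^ k := by
      calc (1 : ℝ) ≤ n * q ^ (k - 1) := by linarith
        _ = n * q ^ (l - 1) * q ^ (k - l) := by rw [h1]; ring
        _ ≤ n * q ^ (l - 1) * r ^ k := by gcongr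
    nlinarith [sq_nonneg (k : ℝ)]
  have hρ : 2 * (k : ℝ) ^ 2 * r ^ k ≤ 1 := by nlinarith
  have hpow : ((k : ℝ) ^ 2) ^ l ≤
      2 * k ^ 2 * r ^ k * (((n : ℝ) / 2) ^ l * (q ^ (l - 1)) ^ l) := by
    have h1 : (k : ℝ) ^ 2 ≤ 2 * k ^ 2 * r ^ k * (n / 2 * q ^ (l - 1)) := by linarith
    calc ((k : ℝ) ^ 2) ^ l ≤ (2 * k ^ 2 * r ^ k * (n / 2 * q ^ (l - 1))) ^ l := by gcongr
      _ = (2 * k ^ 2 * r ^ k) ^ l * (((n : ℝ) / 2) ^ l * (q ^ (l - 1)) ^ l) := by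
        rw [mul_pow, mul_pow (_ / _)]
      _ ≤ _ := by
        gcongr
        exact pow_le_of_le_one (by positivity) hρ (by omega)
  have hA := choose_mul_choose_mul_pow_le (n := n) (k := k) (l := l) (by omega) hkn
  have hB := pairBound_mul_le_sq (l := l) hq0.le hq1 (by omega) hkn hx
  have hpos : 0 < ((n : ℝ) / 2) ^ l * (q ^ (l - 1)) ^ l := by positivity
  refine le_of_mul_le_mul_right ?_ hpos
  have hβ : pairBound q n k l * (q ^ (l - 1)) ^ l ≤ kernelProb q n k ^ 2 * Real.exp 1 :=
    hB.trans (by gcongr)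
  have hβ0 : 0 ≤ kernelProb q n k ^ 2 * Real.exp 1 := by positivity
  calc _ = (((k.choose l * (n - k).choose (k - l) : ℕ) : ℝ) * ((n : ℝ) / 2) ^ l) *
          (pairBound q n k l * (q ^ (l - 1)) ^ l) := by ring
    _ ≤ (((k.choose l * (n - k).choose (k - l) : ℕ) : ℝ) * ((n : ℝ) / 2) ^ l) *
          (kernelProb q n k ^ 2 * Real.exp 1) := by gcongr
    _ ≤ (n.choose k * ((k : ℝ) ^ 2) ^ l) * (kernelProb q n k ^ 2 * Real.exp 1) := by gcongr
    _ ≤ (n.choose k * (2 * k ^ 2 * r ^ k * (((n : ℝ) / 2) ^ l * (q ^ (l - 1)) ^ l))) *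
          (kernelProb q n k ^ 2 * Real.exp 1) := by gcongr
    _ = _ := by ring

/-- The contribution of pairs with large overlap to the second moment. -/
lemma choose_mul_pairBound_le_of_large (hr0 : 0 < r) (hr1 : r < 1) (hq : q = r ^ 2) (hk : 2 ≤ k)
    (hkn : 2 * k ≤ n) (hle : n * q ^ k ≤ k) (hkr : (k : ℝ) ^ 2 * r ^ k ≤ q / 4)
    (hlk : l ≤ k) (hlk' : k < 2 * l) :
    ((k.choose l * (n - k).choose (k - l) : ℕ) : ℝ) * pairBound q n k l ≤ kernelProb q n k := by
  have hq0 : 0 < q := by rw [hq]; positivity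
  have hq1 : q ≤ 1 := by rw [hq]; exact pow_le_one₀ hr0.le hr1.le
  have hB := pairBound_mul_le (l := l) hq0.le hq1 hlk hkn
  have hμ := kernelProb_nonneg (n := n) (k := k) hq0.le hq1
  have hC : ((k.choose l * (n - k).choose (k - l) : ℕ) : ℝ) ≤ ((k : ℝ) * n) ^ (k - l) := by
    rw [mul_pow, ← Nat.choose_symm hlk]
    have h1 : k.choose (k - l) ≤ k ^ (k - l) := Nat.choose_le_pow _ _
    have h2 : (n - k).choose (k - l) ≤ n ^ (k - l) :=
      (Nat.choose_le_pow _ _).trans (Nat.pow_le_pow_left (Nat.sub_le _ _) _)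
    exact_mod_cast Nat.mul_le_mul h1 h2
  have hexp : (q ^ (k - 1)) ^ k = (q ^ k * q ^ (l - 1)) ^ (k - l) * (q ^ (l - 1)) ^ l := by
    obtain ⟨a, rfl⟩ : ∃ a, l = a + 1 := ⟨l - 1, by omega⟩
    obtain ⟨j, rfl⟩ := Nat.exists_eq_add_of_le hlk
    have h2 : a + 1 + j - 1 = a + j := by omega
    have h3 : a + 1 + j - (a + 1) = j := by omega
    rw [h2, h3, Nat.add_sub_cancel]
    simp only [← pow_mul, ← pow_add]
    congr 1
    ring
  have hone : (k : ℝ) * n * (q ^ k * q ^ (l - 1)) ≤ 1 := by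
    have h1 : q ^ (l - 1) * q ≤ r ^ k := by
      rw [← pow_succ, hq, ← pow_mul]
      exact pow_le_pow_of_le_one hr0.le hr1.le (by omega)
    have h2 : (k : ℝ) * n * (q ^ k * q ^ (l - 1)) * q ≤ 1 * q := by
      calc (k : ℝ) * n * (q ^ k * q ^ (l - 1)) * q
          = k * (n * q ^ k) * (q ^ (l - 1) * q) := by ring
        _ ≤ k * k * r ^ k := by gcongr
        _ ≤ 1 * q := by nlinarith
    exact le_of_mul_le_mul_right h2 hq0
  have hpos : 0 < (q ^ (l - 1)) ^ l := by positivity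
  refine le_of_mul_le_mul_right ?_ hpos
  calc _ = ((k.choose l * (n - k).choose (k - l) : ℕ) : ℝ) *
          (pairBound q n k l * (q ^ (l - 1)) ^ l) := by ring
    _ ≤ ((k.choose l * (n - k).choose (k - l) : ℕ) : ℝ) *
          (kernelProb q n k * (q ^ (k - 1)) ^ k) := by gcongr
    _ ≤ ((k : ℝ) * n) ^ (k - l) * (kernelProb q n k * (q ^ (k - 1)) ^ k) := by gcongr
    _ = kernelProb q n k * (q ^ (l - 1)) ^ l *
          ((k : ℝ) * n * (q ^ k * q ^ (l - 1))) ^ (k - l) := by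
        rw [hexp, mul_pow ((k : ℝ) * n)]; ring
    _ ≤ kernelProb q n k * (q ^ (l - 1)) ^ l * 1 := by
        gcongr
        exact pow_le_one₀ (by positivity) hone
    _ = _ := by ring

lemma pairBound_zero (hk : 2 * k ≤ n) : pairBound q n k 0 = kernelProb q n k ^ 2 := by
  have h := pairBound_mul_eq (q := q) (n := n) (k := k) (l := 0) (Nat.zero_le _)
  have h1 : 1 - 2 * q ^ k + q ^ (2 * k) = (1 - q ^ k) ^ 2 := by ring
  simp only [pow_zero, mul_one, Nat.sub_zero] at h
  rw [h, kernelProb, h1, mul_pow, ← pow_mul (1 - q ^ k), ← pow_mul (1 - q ^ k), ← pow_add]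
  congr 2
  omega

lemma factorial_le_pow_mul_exp (hk : 1 ≤ k) :
    (k.factorial : ℝ) ≤ k ^ (k + 1) * Real.exp (1 - k) := by
  induction k, hk using Nat.le_induction with
  | base => simp
  | succ k hk ih =>
    have hk' : (0 : ℝ) < k := by exact_mod_cast hk
    have h1 : (k : ℝ) / (k + 1) ≤ Real.exp (-(1 / (k + 1))) := by
      have := Real.add_one_le_exp (-(1 / ((k : ℝ) + 1)))
      have h2 : (k : ℝ) / (k + 1) = -(1 / (k + 1)) + 1 := by field_simp; ring
      rwa [h2]
    have h2 : (k : ℝ) ^ (k + 1) ≤ (k + 1) ^ (k + 1) * Real.exp (-1) := by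
      have h3 := pow_le_pow_left₀ (by positivity) h1 (k + 1)
      rw [div_pow, div_le_iff₀ (by positivity), ← Real.exp_nat_mul] at h3
      have h4 : ((k + 1 : ℕ) : ℝ) * -(1 / ((k : ℝ) + 1)) = -1 := by push_cast; field_simp
      rw [h4] at h3
      linarith
    rw [Nat.factorial_succ]
    push_cast
    calc ((k : ℝ) + 1) * k.factorial
        ≤ (k + 1) * ((k + 1) ^ (k + 1) * Real.exp (-1) * Real.exp (1 - k)) := by
          gcongr
          exact ih.trans (by gcongr)
      _ = (k + 1) ^ (k + 1 + 1) * Real.exp (1 - (k + 1)) := by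
          rw [mul_assoc _ (Real.exp (-1)), ← Real.exp_add]
          have : -1 + (1 - (k : ℝ)) = 1 - (k + 1) := by ring
          rw [this]; ring

lemma pow_div_two_le_choose_mul (hk : 1 ≤ k) (hkn : 2 * (k : ℝ) ^ 2 ≤ n) :
    (n : ℝ) ^ k / 2 ≤ n.choose k * (k ^ (k + 1) * Real.exp (1 - k)) := by
  have hk' : (1 : ℝ) ≤ k := by exact_mod_cast hk
  have hn : (0 : ℝ) < n := by nlinarith
  have hkn' : (k : ℝ) ≤ n := by nlinarith
  have h1 : (n : ℝ) ^ k / 2 ≤ (n - k) ^ k := by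
    have h2 := one_add_mul_le_pow (a := -((k : ℝ) / n)) (by
      have : (k : ℝ) / n ≤ 1 := (div_le_one hn).2 hkn'
      linarith) k
    have h3 : (1 : ℝ) / 2 ≤ 1 + k * -((k : ℝ) / n) := by
      have : (k : ℝ) * (k / n) ≤ 1 / 2 := by
        rw [← mul_div_assoc, div_le_iff₀ hn]
        nlinarith
      linarith
    have h4 : ((n : ℝ) - k) ^ k = n ^ k * (1 + -((k : ℝ) / n)) ^ k := by
      rw [← mul_pow]; congr 1; field_simp; ring
    rw [h4]
    have : 0 < (n : ℝ) ^ k := by positivity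
    nlinarith
  have h2 : ((n : ℝ) - k) ^ k ≤ n.choose k * k.factorial := by
    have h3 := Nat.pow_le_choose (α := ℝ) k n
    rw [div_le_iff₀ (by positivity)] at h3
    refine le_trans ?_ h3
    have h4 : k ≤ n := by exact_mod_cast hkn'
    have h5 : ((n + 1 - k : ℕ) : ℝ) = n + 1 - k := by
      rw [Nat.cast_sub (by omega)]; push_cast; ring
    push_cast [h5]
    gcongr
    linarith
  refine h1.trans (h2.trans ?_)
  gcongr
  exact factorial_le_pow_mul_exp (by omega)

lemma exp_neg_mul_div_two_le {x : ℝ} (hx0 : 0 ≤ x) (hx : x ≤ 1 / 2) (hn : n * x ^ 2 ≤ 1 / 2) :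
    Real.exp (-(n * x)) / 2 ≤ (1 - x) ^ n := by
  have h1 : Real.exp (-x) * (1 - x ^ 2) ≤ 1 - x := by
    have h2 : Real.exp (-x) * (x + 1) ≤ 1 := by
      calc Real.exp (-x) * (x + 1) ≤ Real.exp (-x) * Real.exp x := by
            gcongr
            exact Real.add_one_le_exp _
        _ = 1 := by rw [← Real.exp_add]; simp
    nlinarith
  have h2 : (1 : ℝ) / 2 ≤ (1 - x ^ 2) ^ n := by
    have h3 := one_add_mul_le_pow (a := -x ^ 2) (by nlinarith) n
    have h5 : 1 + -x ^ 2 = 1 - x ^ 2 := by ring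
    rw [h5] at h3
    linarith
  calc Real.exp (-(n * x)) / 2 = Real.exp (-x) ^ n * (1 / 2) := by
        rw [← Real.exp_nat_mul]; ring_nf
    _ ≤ Real.exp (-x) ^ n * (1 - x ^ 2) ^ n := by gcongr
    _ = (Real.exp (-x) * (1 - x ^ 2)) ^ n := by rw [mul_pow]
    _ ≤ (1 - x) ^ n := by
        have : 0 ≤ 1 - x ^ 2 := by nlinarith
        gcongr

lemma mul_le_mul_exp_of_window {b : ℝ} (hq0 : 0 < q) (hk : 2 ≤ k) (hle : n * q ^ k ≤ k)
    (hge : (k : ℝ) - 1 ≤ n * q ^ (k - 1)) (hb : b ≤ (1 - 1 / k) * Real.exp (1 - q)) :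
    b * k ≤ n * q ^ (k - 1) * Real.exp (1 - n * q ^ k / k) := by
  have hk' : (2 : ℝ) ≤ k := by exact_mod_cast hk
  have hk0 : (0 : ℝ) < k := by linarith
  have hqk : q ^ k = q ^ (k - 1) * q := by rw [← pow_succ]; congr 1; omega
  set t : ℝ := n * q ^ k / k with ht
  set s : ℝ := q * (1 - 1 / k) with hs
  have hk1 : 1 / (k : ℝ) ≤ 1 / 2 := by gcongr
  have hs0 : 0 < s := mul_pos hq0 (by linarith)
  have hsq : s ≤ q := by
    have : 0 < 1 / (k : ℝ) := by positivity
    nlinarith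
  have htk : n * q ^ (k - 1) * q = t * k := by
    rw [ht, hqk]; field_simp
  have hsk : s * k = q * (k - 1) := by rw [hs]; field_simp
  have hst : s ≤ t := by
    refine le_of_mul_le_mul_right ?_ hk0
    rw [hsk, ← htk]
    nlinarith
  have ht1 : t ≤ 1 := (div_le_one hk0).2 hle
  have ht0 : 0 < t := hs0.trans_le hst
  have hmono : s * Real.exp (1 - s) ≤ t * Real.exp (1 - t) := by
    have h1 : s / t ≤ Real.exp (s - t) := by
      have h2 : s / t ≤ Real.exp (s / t - 1) := by
        linarith [Real.add_one_le_exp (s / t - 1)]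
      refine h2.trans (Real.exp_le_exp.2 ?_)
      have h3 : s / t - 1 = (s - t) / t := by field_simp
      rw [h3, div_le_iff₀ ht0]
      nlinarith
    rw [div_le_iff₀ ht0] at h1
    calc s * Real.exp (1 - s) ≤ Real.exp (s - t) * t * Real.exp (1 - s) := by gcongr
      _ = t * (Real.exp (s - t) * Real.exp (1 - s)) := by ring
      _ = t * Real.exp (1 - t) := by rw [← Real.exp_add]; ring_nf
  refine le_of_mul_le_mul_right ?_ hq0
  have hk2 : 0 ≤ 1 - 1 / (k : ℝ) := by linarith
  calc b * k * q ≤ (1 - 1 / k) * Real.exp (1 - q) * k * q := by gcongr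
    _ ≤ (1 - 1 / k) * Real.exp (1 - s) * k * q := by gcongr
    _ = s * Real.exp (1 - s) * k := by rw [hs]; ring
    _ ≤ t * Real.exp (1 - t) * k := by gcongr
    _ = n * q ^ (k - 1) * q * Real.exp (1 - t) := by rw [htk]; ring
    _ = n * q ^ (k - 1) * Real.exp (1 - t) * q := by ring

/-- The expected number of kernels of size `k` is exponentially large in `k`. -/
lemma le_choose_mul_kernelProb {b : ℝ} (hr0 : 0 < r) (hr1 : r < 1) (hq : q = r ^ 2)
    (hk : 2 ≤ k) (hle : n * q ^ k ≤ k) (hge : (k : ℝ) - 1 ≤ n * q ^ (k - 1))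
    (hkr : (k : ℝ) ^ 2 * r ^ k ≤ q / 4) (hkn : 2 * (k : ℝ) ^ 2 ≤ n)
    (hb0 : 0 ≤ b) (hb : b ≤ (1 - 1 / k) * Real.exp (1 - q)) :
    b ^ k ≤ n.choose k * kernelProb q n k * (4 * Real.exp 1 * k) := by
  have hq0 : 0 < q := by rw [hq]; positivity
  have hq1 : q ≤ 1 := by rw [hq]; exact pow_le_one₀ hr0.le hr1.le
  have hk' : (2 : ℝ) ≤ k := by exact_mod_cast hk
  have hk0 : (0 : ℝ) < k := by linarith
  have hxr : q ^ k ≤ r ^ k := by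
    rw [hq, ← pow_mul]
    exact pow_le_pow_of_le_one hr0.le hr1.le (by omega)
  have hx0 : 0 < q ^ k := by positivity
  have hx2 : q ^ k ≤ 1 / 2 := by nlinarith
  have hchoose := pow_div_two_le_choose_mul (by omega) hkn
  have hdom : Real.exp (-(n * q ^ k)) / 2 ≤ (1 - q ^ k) ^ (n - k) := by
    have h4 : n * (q ^ k) ^ 2 ≤ 1 / 2 := by
      calc n * (q ^ k) ^ 2 = n * q ^ k * q ^ k := by ring
        _ ≤ k * r ^ k := by gcongr
        _ ≤ 1 / 2 := by nlinarith [pow_pos hr0 k]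
    exact (exp_neg_mul_div_two_le hx0.le hx2 h4).trans
      (pow_le_pow_of_le_one (by linarith) (by linarith) (Nat.sub_le _ _))
  have hbase := mul_le_mul_exp_of_window hq0 hk hle hge hb
  have hpow : b ^ k * (k : ℝ) ^ k * Real.exp (-k) ≤
      (q ^ (k - 1)) ^ k * n ^ k * Real.exp (-(n * q ^ k)) := by
    have h1 : Real.exp (1 - n * q ^ k / k) ^ k = Real.exp (-(n * q ^ k)) * Real.exp k := by
      rw [← Real.exp_nat_mul, ← Real.exp_add]
      congr 1
      field_simp
      ring
    calc b ^ k * (k : ℝ) ^ k * Real.exp (-k) = (b * k) ^ k * Real.exp (-k) := by rw [mul_pow]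
      _ ≤ (n * q ^ (k - 1) * Real.exp (1 - n * q ^ k / k)) ^ k * Real.exp (-k) := by gcongr
      _ = (q ^ (k - 1)) ^ k * n ^ k * Real.exp (-(n * q ^ k)) *
            (Real.exp k * Real.exp (-k)) := by
          rw [mul_pow, mul_pow, h1]; ring
      _ = _ := by rw [← Real.exp_add]; simp
  have hpos : 0 < (k : ℝ) ^ k * Real.exp (-k) := by positivity
  refine le_of_mul_le_mul_right ?_ hpos
  calc b ^ k * ((k : ℝ) ^ k * Real.exp (-k))
      ≤ (q ^ (k - 1)) ^ k * n ^ k * Real.exp (-(n * q ^ k)) := by rw [← mul_assoc]; exact hpow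
    _ = 4 * (q ^ (k - 1)) ^ k * ((n : ℝ) ^ k / 2 * (Real.exp (-(n * q ^ k)) / 2)) := by ring
    _ ≤ 4 * (q ^ (k - 1)) ^ k * (n.choose k * (k ^ (k + 1) * Real.exp (1 - k)) *
          (1 - q ^ k) ^ (n - k)) := by gcongr
    _ = _ := by
        rw [kernelProb, sub_eq_add_neg 1 (k : ℝ), Real.exp_add]; ring

end Estimates

lemma card_filter_inter_card_le {n : ℕ} (K : Finset (Fin n)) (k l : ℕ) (hK : K.card = k) :
    ((Finset.powersetCard k Finset.univ).filter fun L => (K ∩ L).card = l).card ≤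
      k.choose l * (n - k).choose (k - l) := by
  have hc : (Kᶜ).card = n - k := by rw [Finset.card_compl, Fintype.card_fin, hK]
  rw [← hc, ← Finset.card_powersetCard (k - l) Kᶜ, ← hK, ← Finset.card_powersetCard l K, hK,
    ← Finset.card_product]
  refine Finset.card_le_card_of_injOn (fun L => (K ∩ L, L \ K)) ?_ ?_
  · intro L hL
    simp only [Finset.coe_filter, Finset.mem_powersetCard_univ, Set.mem_ofPred_eq] at hL
    simp only [Finset.coe_product, Set.mem_prod, Finset.mem_coe, Finset.mem_powersetCard]
    refine ⟨⟨Finset.inter_subset_left, hL.2⟩, fun i hi => ?_, ?_⟩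
    · simp only [Finset.mem_sdiff] at hi
      simpa using hi.2
    · have := Finset.card_sdiff_add_card_inter L K
      rw [Finset.inter_comm, hL.2, hL.1] at this
      omega
  · intro L _ L' _ h
    simp only [Prod.mk.injEq] at h
    rw [← Finset.sdiff_union_inter L K, ← Finset.sdiff_union_inter L' K, h.2,
      Finset.inter_comm L, h.1, Finset.inter_comm K]

section SecondMoment

variable {p : ℝ} {n k : ℕ}

/-- The number of kernels of size `k`. -/
noncomputable def kernelCount (n k : ℕ) (ω : EdgeIdx n → Bool) : ℝ :=
  ∑ K ∈ Finset.powersetCard k Finset.univ, kernelInd K ω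

lemma bernoulliExpect_kernelCount :
    bernoulliExpect p (kernelCount n k) = n.choose k * kernelProb (1 - p) n k := by
  have h : ∀ K ∈ Finset.powersetCard k (Finset.univ : Finset (Fin n)),
      bernoulliExpect p (kernelInd K) = kernelProb (1 - p) n k := by
    intro K hK
    rw [Finset.mem_powersetCard_univ] at hK
    rw [bernoulliExpect_kernelInd, hK, kernelProb]
  have h1 := bernoulliExpect_sum (p := p) (Finset.powersetCard k (Finset.univ : Finset (Fin n)))
    fun K => kernelInd K
  refine h1.trans ?_
  rw [Finset.sum_congr rfl h]
  simp

lemma pairBound_nonneg {q : ℝ} {l : ℕ} (hq0 : 0 ≤ q) (hq1 : q ≤ 1) :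
    0 ≤ pairBound q n k l := by
  have h1 : 0 ≤ 1 - q ^ k := sub_nonneg.2 (pow_le_one₀ hq0 hq1)
  have h2 := one_sub_two_mul_add_nonneg (k := k) (l := l) hq0 hq1
  unfold pairBound
  positivity

lemma bernoulliExpect_kernelCount_sq_le (hp0 : 0 ≤ p) (hp1 : p ≤ 1) :
    bernoulliExpect p (fun ω => kernelCount n k ω ^ 2) ≤
      n.choose k * ∑ l ∈ Finset.range (k + 1),
        ((k.choose l * (n - k).choose (k - l) : ℕ) : ℝ) * pairBound (1 - p) n k l := by
  have h1 : (fun ω => kernelCount n k ω ^ 2) = fun ω =>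
      ∑ K ∈ Finset.powersetCard k Finset.univ, ∑ L ∈ Finset.powersetCard k Finset.univ,
        kernelInd K ω * kernelInd L ω := by
    funext ω
    rw [kernelCount, sq, Finset.sum_mul_sum]
  have h2 : ∀ K ∈ Finset.powersetCard k (Finset.univ : Finset (Fin n)),
      bernoulliExpect p (fun ω => ∑ L ∈ Finset.powersetCard k Finset.univ,
        kernelInd K ω * kernelInd L ω) ≤ ∑ l ∈ Finset.range (k + 1),
        ((k.choose l * (n - k).choose (k - l) : ℕ) : ℝ) * pairBound (1 - p) n k l := by
    intro K hK
    rw [Finset.mem_powersetCard_univ] at hK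
    rw [bernoulliExpect_sum _ fun L ω => kernelInd K ω * kernelInd L ω]
    have hmaps : ∀ L ∈ Finset.powersetCard k (Finset.univ : Finset (Fin n)),
        (K ∩ L).card ∈ Finset.range (k + 1) := by
      intro L _
      rw [Finset.mem_range, Nat.lt_succ_iff, ← hK]
      exact Finset.card_le_card Finset.inter_subset_left
    rw [← Finset.sum_fiberwise_of_maps_to hmaps]
    refine Finset.sum_le_sum fun l _ => ?_
    have h3 : ∀ L ∈ (Finset.powersetCard k Finset.univ).filter fun L => (K ∩ L).card = l,
        bernoulliExpect p (fun ω => kernelInd K ω * kernelInd L ω) ≤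
          pairBound (1 - p) n k l := by
      intro L hL
      rw [Finset.mem_filter, Finset.mem_powersetCard_univ] at hL
      exact bernoulliExpect_kernelInd_mul_le hp0 hp1 hK hL.1 hL.2
    refine (Finset.sum_le_card_nsmul _ _ _ h3).trans ?_
    rw [nsmul_eq_mul]
    refine mul_le_mul_of_nonneg_right ?_ (pairBound_nonneg (by linarith) (by linarith))
    exact_mod_cast card_filter_inter_card_le K k l hK
  rw [h1, bernoulliExpect_sum _ fun K ω => ∑ L ∈ Finset.powersetCard k Finset.univ,
        kernelInd K ω * kernelInd L ω]
  refine (Finset.sum_le_card_nsmul _ _ _ h2).trans (le_of_eq ?_)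
  simp

open Classical in
lemma probRandomDigraph_eq (A : Set (EdgeIdx n → Bool)) :
    probRandomDigraph n p A = bernoulliExpect p fun ω => if ω ∈ A then 1 else 0 := by
  unfold probRandomDigraph bernoulliExpect
  refine Finset.sum_congr rfl fun ω _ => ?_
  beta_reduce
  by_cases hω : ω ∈ A
  · rw [if_pos hω, if_pos hω, mul_one]
  · rw [if_neg hω, if_neg hω, mul_zero]

lemma probRandomDigraph_nonneg (hp0 : 0 ≤ p) (hp1 : p ≤ 1) (A : Set (EdgeIdx n → Bool)) :
    0 ≤ probRandomDigraph n p A :=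
  Finset.sum_nonneg fun ω _ => by
    split_ifs
    · exact bernoulliWeight_nonneg hp0 hp1 ω
    · exact le_rfl

lemma probRandomDigraph_le_one (hp0 : 0 ≤ p) (hp1 : p ≤ 1) (A : Set (EdgeIdx n → Bool)) :
    probRandomDigraph n p A ≤ 1 := by
  rw [probRandomDigraph_eq]
  refine (bernoulliExpect_mono (G := fun _ => 1) hp0 hp1 fun ω => ?_).trans bernoulliExpect_one.le
  by_cases hω : ω ∈ A
  · rw [if_pos hω]
  · rw [if_neg hω]
    exact zero_le_one

lemma bernoulliExpect_kernelInd_le (hp0 : 0 ≤ p) (hp1 : p ≤ 1) (K : Finset (Fin n)) :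
    bernoulliExpect p (kernelInd K) ≤
      probRandomDigraph n p {ω | ∃ K : Set (Fin n), IsKernel (gOf n ω) K} := by
  rw [probRandomDigraph_eq]
  refine bernoulliExpect_mono hp0 hp1 fun ω => ?_
  unfold kernelInd
  by_cases hK : IsKernel (gOf n ω) (K : Set (Fin n))
  · rw [if_pos hK, if_pos ⟨_, hK⟩]
  · rw [if_neg hK]
    split_ifs <;> norm_num

lemma sq_le_probRandomDigraph_mul (hp0 : 0 ≤ p) (hp1 : p ≤ 1) :
    bernoulliExpect p (kernelCount n k) ^ 2 ≤
      probRandomDigraph n p {ω | ∃ K : Set (Fin n), IsKernel (gOf n ω) K} *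
        bernoulliExpect p (fun ω => kernelCount n k ω ^ 2) := by
  classical
  rw [probRandomDigraph_eq]
  refine bernoulliExpect_sq_le hp0 hp1 (fun ω => by split_ifs <;> norm_num) fun ω => ?_
  split_ifs with h
  · rw [mul_one]
  · rw [mul_zero, kernelCount]
    refine (Finset.sum_eq_zero fun K _ => ?_).symm
    rw [kernelInd, if_neg]
    exact fun hK => h ⟨K, hK⟩

lemma bernoulliExpect_kernelCount_sq_le_sq_mul {r b : ℝ} (hp0 : 0 ≤ p) (hr0 : 0 < r) (hr1 : r < 1)
    (hq : 1 - p = r ^ 2) (hk : 2 ≤ k)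
    (hle : n * (1 - p) ^ k ≤ k) (hge : (k : ℝ) - 1 ≤ n * (1 - p) ^ (k - 1))
    (hkr : (k : ℝ) ^ 2 * r ^ k ≤ (1 - p) / 4)
    (hb0 : 0 < b) (hb : b ≤ (1 - 1 / k) * Real.exp p) :
    0 < bernoulliExpect p (kernelCount n k) ∧
      bernoulliExpect p (fun ω => kernelCount n k ω ^ 2) ≤
        bernoulliExpect p (kernelCount n k) ^ 2 *
          (1 + k * (Real.exp 1 * (2 * k ^ 2 * r ^ k) + 4 * Real.exp 1 * k / b ^ k)) := by
  rw [bernoulliExpect_kernelCount]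
  have hq0 : 0 < 1 - p := by rw [hq]; positivity
  have hp1 : p ≤ 1 := by linarith
  have hq1 : 1 - p ≤ 1 := by linarith
  have hk' : (2 : ℝ) ≤ k := by exact_mod_cast hk
  have hk0 : (0 : ℝ) < k := by linarith
  have hn2 : 2 * (k : ℝ) ^ 2 ≤ n := by
    have h1 : (1 - p) ^ (k - 1) * (1 - p) ≤ r ^ k := by
      rw [← pow_succ, hq, ← pow_mul]
      exact pow_le_pow_of_le_one hr0.le hr1.le (by omega)
    have h2 : (1 : ℝ) * (1 - p) ≤ n * r ^ k := by
      calc (1 : ℝ) * (1 - p) ≤ n * (1 - p) ^ (k - 1) * (1 - p) := by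
            gcongr; linarith
        _ = n * ((1 - p) ^ (k - 1) * (1 - p)) := by ring
        _ ≤ n * r ^ k := by gcongr
    have hrk : 0 < r ^ k := by positivity
    refine le_of_mul_le_mul_right ?_ hrk
    linarith
  have hkn : 2 * k ≤ n := by
    have : 2 * (k : ℝ) ≤ n := by nlinarith
    exact_mod_cast this
  set μ := kernelProb (1 - p) n k with hμ
  set E : ℝ := n.choose k * μ with hE
  set δ : ℝ := Real.exp 1 * (2 * k ^ 2 * r ^ k) with hδ
  set η : ℝ := 4 * Real.exp 1 * k / b ^ k with hη
  have hμ0 : 0 ≤ μ := kernelProb_nonneg hq0.le hq1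
  have hδ0 : 0 ≤ δ := by positivity
  have hη0 : 0 ≤ η := by positivity
  have hbk : b ^ k ≤ E * (4 * Real.exp 1 * k) :=
    le_choose_mul_kernelProb hr0 hr1 hq hk hle hge hkr hn2 hb0.le (by rwa [sub_sub_cancel])
  have hE0 : 0 < E := by
    have h1 : 0 < b ^ k := by positivity
    have h2 : 0 < 4 * Real.exp 1 * k := by positivity
    exact pos_of_mul_pos_left (h1.trans_le hbk) h2.le
  have hEη : E ≤ E ^ 2 * η := by
    have h1 : 1 ≤ E * η := by
      rw [hη, ← mul_div_assoc, le_div_iff₀ (by positivity), one_mul]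
      exact hbk
    nlinarith
  have hterm : ∀ l ∈ Finset.range k, n.choose k *
      (((k.choose (l + 1) * (n - k).choose (k - (l + 1)) : ℕ) : ℝ) *
        pairBound (1 - p) n k (l + 1)) ≤ E ^ 2 * (δ + η) := by
    intro l hl
    rw [Finset.mem_range] at hl
    by_cases h : 2 * (l + 1) ≤ k
    · have h1 := choose_mul_pairBound_le_of_small hr0 hr1 hq hk hkn hle hge hkr
        (Nat.succ_le_succ (Nat.zero_le l)) h
      calc _ ≤ n.choose k * (n.choose k * μ ^ 2 * δ) := by gcongr
        _ = E ^ 2 * δ := by rw [hE]; ring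
        _ ≤ E ^ 2 * (δ + η) := by gcongr; linarith
    · have h1 := choose_mul_pairBound_le_of_large hr0 hr1 hq hk hkn hle hkr
        (l := l + 1) (by omega) (by omega)
      calc _ ≤ n.choose k * μ := by gcongr
        _ ≤ E ^ 2 * η := hEη
        _ ≤ E ^ 2 * (δ + η) := by gcongr; linarith
  refine ⟨hE0, ?_⟩
  refine (bernoulliExpect_kernelCount_sq_le hp0 hp1).trans ?_
  rw [Finset.mul_sum, Finset.sum_range_succ', pairBound_zero hkn]
  have h1 := Finset.sum_le_card_nsmul _ _ _ hterm
  rw [Finset.card_range, nsmul_eq_mul] at h1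
  have h2 : ((n - k).choose k : ℝ) ≤ n.choose k := by
    exact_mod_cast Nat.choose_le_choose k (Nat.sub_le n k)
  have h3 : (n.choose k : ℝ) * (((k.choose 0 * (n - k).choose (k - 0) : ℕ) : ℝ) * μ ^ 2) ≤
      E ^ 2 := by
    rw [Nat.choose_zero_right, one_mul, Nat.sub_zero]
    calc (n.choose k : ℝ) * ((n - k).choose k * μ ^ 2)
        ≤ n.choose k * (n.choose k * μ ^ 2) := by gcongr
      _ = E ^ 2 := by rw [hE]; ring
  linarith

lemma one_sub_le_probRandomDigraph {ε : ℝ} (hp0 : 0 ≤ p) (hp1 : p ≤ 1) (hε : 0 ≤ ε)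
    (hE : 0 < bernoulliExpect p (kernelCount n k))
    (h : bernoulliExpect p (fun ω => kernelCount n k ω ^ 2) ≤
      bernoulliExpect p (kernelCount n k) ^ 2 * (1 + ε)) :
    1 - ε ≤ probRandomDigraph n p {ω | ∃ K : Set (Fin n), IsKernel (gOf n ω) K} := by
  have hcs := sq_le_probRandomDigraph_mul (n := n) (k := k) hp0 hp1
  have hP0 := probRandomDigraph_nonneg hp0 hp1
    {ω : EdgeIdx n → Bool | ∃ K : Set (Fin n), IsKernel (gOf n ω) K}
  have hP1 := probRandomDigraph_le_one hp0 hp1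
    {ω : EdgeIdx n → Bool | ∃ K : Set (Fin n), IsKernel (gOf n ω) K}
  generalize probRandomDigraph n p _ = P at *
  generalize bernoulliExpect p (kernelCount n k) = E at *
  have h1 : E ^ 2 * 1 ≤ E ^ 2 * (P * (1 + ε)) := by
    calc E ^ 2 * 1 = E ^ 2 := mul_one _
      _ ≤ _ := hcs
      _ ≤ P * (E ^ 2 * (1 + ε)) := mul_le_mul_of_nonneg_left h hP0
      _ = _ := by ring
  have h2 := le_of_mul_le_mul_left h1 (by positivity)
  nlinarith

end SecondMoment

/-- A slowly growing `k` for which `n * q ^ k` is of order `k`. -/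
lemma exists_window {q : ℝ} (hq0 : 0 < q) (hq1 : q < 1) :
    ∃ f : ℕ → ℕ, Filter.Tendsto f Filter.atTop Filter.atTop ∧
      ∀ n, n * q ^ f n ≤ f n ∧ (2 ≤ f n → (f n : ℝ) - 1 ≤ n * q ^ (f n - 1)) := by
  classical
  have hex : ∀ n : ℕ, ∃ k : ℕ, (n : ℝ) * q ^ k ≤ k := by
    intro n
    refine ⟨n, ?_⟩
    exact mul_le_of_le_one_right (Nat.cast_nonneg n) (pow_le_one₀ hq0.le hq1.le)
  refine ⟨fun n => Nat.find (hex n), ?_, fun n => ⟨Nat.find_spec (hex n), fun h => ?_⟩⟩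
  · refine Filter.tendsto_atTop.2 fun M => ?_
    obtain ⟨N, hN⟩ := exists_nat_gt ((M : ℝ) / q ^ M)
    refine Filter.eventually_atTop.2 ⟨N, fun n hn => ?_⟩
    by_contra! hlt
    have hspec := Nat.find_spec (hex n)
    have h1 : (n : ℝ) * q ^ M ≤ M := by
      calc (n : ℝ) * q ^ M ≤ n * q ^ Nat.find (hex n) := by
            gcongr ?_ * ?_
            exact pow_le_pow_of_le_one hq0.le hq1.le hlt.le
        _ ≤ Nat.find (hex n) := hspec
        _ ≤ M := by exact_mod_cast hlt.le
    rw [div_lt_iff₀ (by positivity)] at hN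
    have h2 : (N : ℝ) * q ^ M ≤ n * q ^ M := by gcongr
    linarith
  · replace h : 2 ≤ Nat.find (hex n) := h
    have h1 := Nat.find_min (hex n) (m := Nat.find (hex n) - 1) (by omega)
    push Not at h1
    rw [Nat.cast_sub (by omega)] at h1
    push_cast at h1
    exact h1.le

/-- de la Vega / Tomescu. For any fixed `p ∈ [0,1]`, the probability
that the random digraph `G(n,p)` contains a kernel tends to `1` as `n → ∞`. -/
theorem kernel_exists_whp_in_random_digraph
    (p : ℝ) (hp0 : 0 ≤ p) (hp1 : p ≤ 1) :
    Filter.Tendsto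
      (fun n : ℕ =>
        probRandomDigraph n p {ω | ∃ K : Set (Fin n), IsKernel (gOf n ω) K})
      Filter.atTop (nhds 1) := by
  rcases hp0.eq_or_lt with rfl | hp0'
  · refine tendsto_const_nhds.congr fun n => le_antisymm ?_ (probRandomDigraph_le_one hp0 hp1 _)
    refine le_trans (le_of_eq ?_) (bernoulliExpect_kernelInd_le hp0 hp1 Finset.univ)
    simp [bernoulliExpect_kernelInd]
  rcases hp1.eq_or_lt with rfl | hp1'
  · refine tendsto_const_nhds.congr' ?_
    filter_upwards [Filter.eventually_gt_atTop 0] with n hn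
    refine le_antisymm ?_ (probRandomDigraph_le_one hp0 hp1 _)
    refine le_trans (le_of_eq ?_) (bernoulliExpect_kernelInd_le hp0 hp1 {⟨0, hn⟩})
    simp [bernoulliExpect_kernelInd]
  set r := Real.sqrt (1 - p) with hr
  have hq : 1 - p = r ^ 2 := (Real.sq_sqrt (by linarith)).symm
  have hr0 : 0 < r := Real.sqrt_pos.2 (by linarith)
  have hr1 : r < 1 := by nlinarith
  set b := Real.exp (p / 2) with hbdef
  have hb0 : 0 < b := Real.exp_pos _
  have hb1 : 1 < b := Real.one_lt_exp_iff.2 (by linarith)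
  obtain ⟨f, hf, hwin⟩ := exists_window (q := 1 - p) (by linarith) (by linarith)
  have hrabs : |r| < 1 := by rwa [abs_of_pos hr0]
  have hbabs : |b⁻¹| < 1 := by
    rw [abs_of_pos (inv_pos.2 hb0)]
    exact inv_lt_one_of_one_lt₀ hb1
  have herr : Filter.Tendsto (fun k : ℕ => 1 - k * (Real.exp 1 * (2 * k ^ 2 * r ^ k) +
      4 * Real.exp 1 * k / b ^ k)) Filter.atTop (nhds 1) := by
    have h1 := (tendsto_pow_const_mul_const_pow_of_abs_lt_one 3 hrabs).const_mul
      (2 * Real.exp 1)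
    have h2 := (tendsto_pow_const_mul_const_pow_of_abs_lt_one 2 hbabs).const_mul
      (4 * Real.exp 1)
    have h3 := (h1.add h2).const_sub 1
    simp only [mul_zero, add_zero, sub_zero] at h3
    refine h3.congr fun k => ?_
    rw [inv_pow]
    ring
  have hsmall : ∀ᶠ k : ℕ in Filter.atTop, (k : ℝ) ^ 2 * r ^ k ≤ (1 - p) / 4 :=
    (tendsto_pow_const_mul_const_pow_of_abs_lt_one 2 hrabs).eventually_le_const (by linarith)
  have hbase : ∀ᶠ k : ℕ in Filter.atTop, b ≤ (1 - 1 / (k : ℝ)) * Real.exp p := by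
    have h1 := (tendsto_one_div_atTop_nhds_zero_nat (𝕜 := ℝ)).const_sub 1
    have h2 := h1.mul_const (Real.exp p)
    rw [sub_zero, one_mul] at h2
    exact h2.eventually_const_le (Real.exp_lt_exp.2 (by linarith))
  refine tendsto_of_tendsto_of_tendsto_of_le_of_le' (herr.comp hf) tendsto_const_nhds ?_
    (Filter.Eventually.of_forall fun n => probRandomDigraph_le_one hp0 hp1 _)
  filter_upwards [hf.eventually hsmall, hf.eventually hbase,
    hf.eventually (Filter.eventually_ge_atTop 2)] with n h1 h2 h3
  obtain ⟨hE, hsq⟩ := bernoulliExpect_kernelCount_sq_le_sq_mul hp0 hr0 hr1 hq h3 (hwin n).1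
    ((hwin n).2 h3) h1 hb0 h2
  exact one_sub_le_probRandomDigraph hp0 hp1 (by positivity) hE hsq
end

section
/- If every directed cycle of a finite digraph G has odd length, then G has at most one kernel. -/
/-- Every orbit of a self-map of a finite type meets the periodic points. -/
theorem exists_iterate_mem_periodicPts {α : Type*} [Finite α] (f : α → α) (x : α) :
    ∃ m, f^[m] x ∈ Function.periodicPts f := by
  obtain ⟨a, b, hab, h⟩ : ∃ a b, a < b ∧ f^[a] x = f^[b] x := by
    obtain ⟨a, b, hne, h⟩ := Finite.exists_ne_map_eq_of_infinite (fun m : ℕ => f^[m] x)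
    rcases lt_or_gt_of_ne hne with hlt | hlt
    · exact ⟨a, b, hlt, h⟩
    · exact ⟨b, a, hlt, h.symm⟩
  refine ⟨a, b - a, Nat.sub_pos_of_lt hab, ?_⟩
  change f^[b - a] (f^[a] x) = f^[a] x
  rw [← Function.iterate_add_apply, Nat.sub_add_cancel hab.le, h]

/-- The orbit of a periodic point is a directed cycle if the map follows edges along it. -/
theorem isDirCycle_iterate {n : ℕ} {g : Fin n → Fin n → ℝ} {f : Fin n → Fin n} {y : Fin n}
    (hy : y ∈ Function.periodicPts f) (hg : ∀ m, g (f^[m] y) (f (f^[m] y)) = 1) :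
    IsDirCycle g (Function.minimalPeriod f y) (fun i => f^[i.1] y) := by
  refine ⟨Function.minimalPeriod_pos_of_mem_periodicPts hy, fun i j hij => ?_, fun i => ?_⟩
  · exact Fin.ext (Function.iterate_injOn_Iio_minimalPeriod i.2 j.2 hij)
  · change g (f^[i.1] y) (f^[(i.1 + 1) % Function.minimalPeriod f y] y) = 1
    rw [Function.iterate_mod_minimalPeriod_eq, Function.iterate_succ_apply']
    exact hg i.1

/-- From a vertex in exactly one of two kernels there is an edge to a vertex that is in exactly
the other one. -/
theorem IsKernel.exists_adj_symmDiff {n : ℕ} {g : Fin n → Fin n → ℝ} {K₁ K₂ : Set (Fin n)}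
    (h₁ : IsKernel g K₁) (h₂ : IsKernel g K₂) {i : Fin n} (hi : i ∈ K₁ ↔ i ∉ K₂) :
    ∃ j, (j ∈ K₁ ↔ j ∉ K₂) ∧ (j ∈ K₁ ↔ i ∉ K₁) ∧ g i j = 1 := by
  by_cases hi₁ : i ∈ K₁
  · obtain ⟨j, hj, hij⟩ := h₂.2 i (hi.1 hi₁)
    have hj₁ : j ∉ K₁ := fun hj₁ => by simp [h₁.1 i hi₁ j hj₁] at hij
    exact ⟨j, by tauto, by tauto, hij⟩
  · obtain ⟨j, hj, hij⟩ := h₁.2 i hi₁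
    have hi₂ : i ∈ K₂ := by tauto
    have hj₂ : j ∉ K₂ := fun hj₂ => by simp [h₂.1 i hi₂ j hj₂] at hij
    exact ⟨j, by tauto, by tauto, hij⟩

/-- If every directed cycle of a finite digraph has odd length,
then the digraph has at most one kernel. -/
theorem kernel_unique_of_all_cycles_odd
    {n : ℕ} (g : Fin n → Fin n → ℝ)
    (hg01 : ∀ i j, g i j = 0 ∨ g i j = 1) (hgdiag : ∀ i, g i i = 0)
    (hodd : ∀ (k : ℕ) (v : Fin k → Fin n), IsDirCycle g k v → Odd k) :
    ∀ K₁ K₂ : Set (Fin n), IsKernel g K₁ → IsKernel g K₂ → K₁ = K₂ := by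
  intro K₁ K₂ h₁ h₂
  ext x
  by_contra hx
  have hstep : ∀ i, ∃ j, (i ∈ K₁ ↔ i ∉ K₂) →
      (j ∈ K₁ ↔ j ∉ K₂) ∧ (j ∈ K₁ ↔ i ∉ K₁) ∧ g i j = 1 := by
    intro i
    by_cases hi : i ∈ K₁ ↔ i ∉ K₂
    · obtain ⟨j, hj⟩ := h₁.exists_adj_symmDiff h₂ hi
      exact ⟨j, fun _ => hj⟩
    · exact ⟨i, fun h => absurd h hi⟩
  choose f hf using hstep
  have hmem : ∀ z, (z ∈ K₁ ↔ z ∉ K₂) → ∀ m, (f^[m] z ∈ K₁ ↔ f^[m] z ∉ K₂) := by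
    intro z hz m
    induction m with
    | zero => exact hz
    | succ m ih =>
      rw [Function.iterate_succ_apply']
      exact (hf _ ih).1
  obtain ⟨a, hper⟩ := exists_iterate_mem_periodicPts f x
  have hy := hmem x (by tauto) a
  set y := f^[a] x
  have hpar : ∀ m, (f^[m] y ∈ K₁ ↔ (Even m ↔ y ∈ K₁)) := by
    intro m
    induction m with
    | zero => simp
    | succ m ih =>
      rw [Function.iterate_succ_apply', (hf _ (hmem y hy m)).2.1, ih, Nat.even_add_one]
      tauto
  have hk := hodd _ _ (isDirCycle_iterate hper fun m => (hf _ (hmem y hy m)).2.2)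
  have hreturn := hpar (Function.minimalPeriod f y)
  rw [Function.iterate_minimalPeriod] at hreturn
  have hne := Nat.not_even_iff_odd.2 hk
  tauto
end

section
/- Let G be a digraph on N, let s(G) be its symmetrization with entries ḡ_ij = max(g_ij, g_ji), and let Ĝ be any digraph with g_ij ≤ ĝ_ij ≤ ḡ_ij for all i,j (a partial symmetrization of G). If e is a specialized equilibrium of the public goods game on G, then e is also a specialized equilibrium of the public goods game on Ĝ; equivalently, every kernel of G is a kernel of Ĝ. -/
theorem IsSpecEq.eq_zero_or_eq {n : ℕ} {g : Fin n → Fin n → ℝ} {estar : ℝ} {e : Fin n → ℝ}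
    (h : IsSpecEq g estar e) (i : Fin n) : e i = 0 ∨ e i = estar :=
  (le_or_gt estar (∑ j, g i j * e j)).imp (h i).1 (h i).2

theorem IsSpecEq.nonneg {n : ℕ} {g : Fin n → Fin n → ℝ} {estar : ℝ} {e : Fin n → ℝ}
    (h : IsSpecEq g estar e) (hestar : 0 < estar) (i : Fin n) : 0 ≤ e i := by
  rcases h.eq_zero_or_eq i with h0 | h1
  · exact h0.ge
  · exact h1 ▸ hestar.le

/-- The specialists of a specialized equilibrium form an independent set. -/
theorem IsSpecEq.adj_eq_zero {n : ℕ} {g : Fin n → Fin n → ℝ} {estar : ℝ} {e : Fin n → ℝ}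
    (h : IsSpecEq g estar e) (hestar : 0 < estar) (hg01 : ∀ i j, g i j = 0 ∨ g i j = 1)
    {i j : Fin n} (hi : e i = estar) (hj : e j = estar) : g i j = 0 := by
  refine (hg01 i j).resolve_right fun hij => ?_
  have hnonneg : ∀ k ∈ Finset.univ, 0 ≤ g i k * e k := fun k _ =>
    mul_nonneg (by rcases hg01 i k with h | h <;> simp [h]) (h.nonneg hestar k)
  have hle := Finset.single_le_sum hnonneg (Finset.mem_univ j)
  rw [hij, hj, one_mul] at hle
  exact hestar.ne' (hi ▸ (h i).1 hle)

/-- Equilibrium monotonicity in network reciprocity.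
Let `ĝ` be a partial symmetrization of `g`, i.e. `g ⊆ ĝ ⊆ s(g)` where
`s(g) i j = max (g i j) (g j i)`. Then every specialized equilibrium of the game
on `g` is a specialized equilibrium of the game on `ĝ`; equivalently, every kernel
of `g` is a kernel of `ĝ`. -/
theorem specEq_and_kernel_monotone_in_reciprocity
    {n : ℕ} (g ghat : Fin n → Fin n → ℝ)
    (hg01 : ∀ i j, g i j = 0 ∨ g i j = 1)
    (hgdiag : ∀ i, g i i = 0)
    (hghat01 : ∀ i j, ghat i j = 0 ∨ ghat i j = 1)
    (hsub : ∀ i j, g i j ≤ ghat i j)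
    (hsup : ∀ i j, ghat i j ≤ max (g i j) (g j i))
    (estar : ℝ) (hestar : 0 < estar) :
    (∀ e : Fin n → ℝ, IsSpecEq g estar e → IsSpecEq ghat estar e) ∧
    (∀ K : Set (Fin n), IsKernel g K → IsKernel ghat K) := by
  have hzero : ∀ i j, g i j = 0 → g j i = 0 → ghat i j = 0 := fun i j hij hji => by
    have hle := hsup i j
    rw [hij, hji, max_self] at hle
    exact le_antisymm hle (hij ▸ hsub i j)
  refine ⟨fun e he i => ?_, fun K hK => ⟨fun i hi j hj => ?_, fun i hi => ?_⟩⟩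
  · rcases he.eq_zero_or_eq i with hi | hi
    · refine ⟨fun _ => hi, fun hlt => (he i).2 (lt_of_le_of_lt ?_ hlt)⟩
      exact Finset.sum_le_sum fun j _ =>
        mul_le_mul_of_nonneg_right (hsub i j) (he.nonneg hestar j)
    · have hsum : ∑ j, ghat i j * e j = 0 := Finset.sum_eq_zero fun j _ => by
        rcases he.eq_zero_or_eq j with hj | hj
        · rw [hj, mul_zero]
        · rw [hzero i j (he.adj_eq_zero hestar hg01 hi hj) (he.adj_eq_zero hestar hg01 hj hi),
            zero_mul]
      exact ⟨fun hle => absurd (hsum ▸ hle) hestar.not_ge, fun _ => hi⟩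
  · exact hzero i j (hK.1 i hi j hj) (hK.1 j hj i hi)
  · obtain ⟨j, hj, hij⟩ := hK.2 i hi
    refine ⟨j, hj, (hghat01 i j).resolve_left fun h0 => ?_⟩
    have hle := hsub i j
    rw [hij, h0] at hle
    exact one_pos.not_ge hle
end

section
/- Let Ḡ be an undirected graph on N (symmetric adjacency ḡ with ḡ_ii = 0) and let K be any maximal independent set of Ḡ. Then there exists a strict digraph G (i.e., g_ij · g_ji = 0 for all i,j) whose symmetrization is Ḡ and for which K is a kernel; equivalently, the specialized equilibrium of the game on Ḡ with contributor set K is also a specialized equilibrium of the game on G. -/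
/-- The profile in which exactly the members of a kernel contribute is a specialized equilibrium. -/
theorem IsKernel.isSpecEq {n : ℕ} {g : Fin n → Fin n → ℝ} {K : Set (Fin n)}
    (hK : IsKernel g K) (hg : ∀ i j, 0 ≤ g i j) {estar : ℝ} (hestar : 0 < estar)
    {e : Fin n → ℝ} (heK : ∀ i ∈ K, e i = estar) (heKc : ∀ i ∉ K, e i = 0) :
    IsSpecEq g estar e := by
  have he : ∀ j, 0 ≤ e j := fun j => by
    by_cases hj : j ∈ K
    · exact (heK j hj).symm ▸ hestar.le
    · exact (heKc j hj).ge
  intro i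
  by_cases hi : i ∈ K
  · have hsum : ∑ j, g i j * e j = 0 := Finset.sum_eq_zero fun j _ => by
      by_cases hj : j ∈ K
      · rw [hK.1 i hi j hj, zero_mul]
      · rw [heKc j hj, mul_zero]
    exact ⟨fun h => absurd (hsum ▸ h) hestar.not_ge, fun _ => heK i hi⟩
  · obtain ⟨j, hj, hij⟩ := hK.2 i hi
    have hle : g i j * e j ≤ ∑ k, g i k * e k :=
      Finset.single_le_sum (f := fun k => g i k * e k)
        (fun k _ => mul_nonneg (hg i k) (he k)) (Finset.mem_univ j)
    rw [hij, one_mul, heK j hj] at hle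
    exact ⟨fun _ => heKc i hi, fun h => absurd hle h.not_ge⟩

open scoped Classical in
/-- The orientation of `gbar` in which every edge meeting `K` points into `K`
and every other edge points to its larger endpoint. -/
noncomputable def orientToward {n : ℕ} (gbar : Fin n → Fin n → ℝ) (K : Set (Fin n))
    (i j : Fin n) : ℝ :=
  if i ∉ K ∧ (j ∈ K ∨ i < j) then gbar i j else 0

/-- Let `ḡ` be an undirected graph (symmetric `{0,1}` adjacency,
zero diagonal) and `K` a maximal independent set of `ḡ`. Then there exists a strict
digraph `g` (no bidirectional edges) whose symmetrization is `ḡ` and for which `K`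
is a kernel; equivalently, the specialized profile with contributor set `K` is a
specialized equilibrium of the game on `g` (as it is of the game on `ḡ`). -/
theorem strict_orientation_of_maxIndep
    {n : ℕ} (gbar : Fin n → Fin n → ℝ)
    (hbar01 : ∀ i j, gbar i j = 0 ∨ gbar i j = 1)
    (hbardiag : ∀ i, gbar i i = 0)
    (hbarsymm : ∀ i j, gbar i j = gbar j i)
    (K : Set (Fin n))
    (hKindep : ∀ i ∈ K, ∀ j ∈ K, gbar i j = 0)
    (hKmax : ∀ i ∉ K, ∃ j ∈ K, gbar i j = 1)
    (estar : ℝ) (hestar : 0 < estar)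
    (e : Fin n → ℝ)
    (heK : ∀ i ∈ K, e i = estar) (heKc : ∀ i ∉ K, e i = 0) :
    ∃ g : Fin n → Fin n → ℝ,
      (∀ i j, g i j = 0 ∨ g i j = 1) ∧
      (∀ i, g i i = 0) ∧
      (∀ i j, g i j = 1 → g j i = 0) ∧
      (∀ i j, max (g i j) (g j i) = gbar i j) ∧
      IsKernel g K ∧
      IsSpecEq g estar e := by
  have h01 : ∀ i j, orientToward gbar K i j = 0 ∨ orientToward gbar K i j = 1 := fun i j => by
    unfold orientToward
    split_ifs
    · exact hbar01 i j
    · exact .inl rfl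
  have hker : IsKernel (orientToward gbar K) K := by
    refine ⟨fun i hi j _ => if_neg fun h => h.1 hi, fun i hi => ?_⟩
    obtain ⟨j, hj, hij⟩ := hKmax i hi
    exact ⟨j, hj, (if_pos ⟨hi, .inl hj⟩).trans hij⟩
  refine ⟨orientToward gbar K, h01, fun i => ?_, fun i j h => ?_, fun i j => ?_, hker,
    hker.isSpecEq (fun i j => ?_) hestar heK heKc⟩
  · simp [orientToward]
  · unfold orientToward at h ⊢
    grind
  · have hnonneg : 0 ≤ gbar i j := by rcases hbar01 i j with h | h <;> simp [h]
    unfold orientToward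
    rw [hbarsymm j i]
    by_cases hi : i ∈ K <;> by_cases hj : j ∈ K
    · simp [hi, hj, hKindep i hi j hj]
    · simp [hi, hj, hnonneg]
    · simp [hi, hj, hnonneg]
    · rcases lt_trichotomy i j with h | rfl | h
      · simp [hi, hj, h, h.not_gt, hnonneg]
      · simp [hbardiag]
      · simp [hi, hj, h, h.not_gt, hnonneg]
  · rcases h01 i j with h | h <;> simp [h]
end

section
/- Let G be a digraph on N, let e* > 0, and let f : [0,∞)^N → [0,∞)^N be the best-response map f_i(e) = max(0, e* − Σ_j g_ij e_j). If e is a fixed point of f (a Nash equilibrium) that is not specialized, i.e. e_i ∉ {0, e*} for some player i, then e is unstable: for every ρ > 0 there is a perturbation ε with |ε_i| ≤ ρ and e_i + ε_i ≥ 0 for all i such that the iterates f^(r)(e + ε) do not converge to e. -/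
/-- The best-response map of the public goods game on the digraph `g` with
threshold `e*`: `f i (e) = max (0, e* - ∑ j, g i j * e j)`. -/
def brMap {n : ℕ} (g : Fin n → Fin n → ℝ) (estar : ℝ) (e : Fin n → ℝ) : Fin n → ℝ :=
  fun i => max 0 (estar - ∑ j, g i j * e j)

/-- The best-response map is antitone when the adjacency weights are nonnegative. -/
theorem brMap_antitone {n : ℕ} {g : Fin n → Fin n → ℝ} (hg : ∀ i j, 0 ≤ g i j) (estar : ℝ) :
    Antitone (brMap g estar) := fun _ _ hxy i =>
  max_le_max le_rfl
    (sub_le_sub_left (Finset.sum_le_sum fun j _ => mul_le_mul_of_nonneg_left (hxy j) (hg i j)) _)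

/-- At an equilibrium, a player with effort strictly between `0` and `e*` listens to
another such player. -/
theorem exists_interior_neighbor {n : ℕ} {g : Fin n → Fin n → ℝ}
    (hg01 : ∀ i j, g i j = 0 ∨ g i j = 1) {estar : ℝ} {e : Fin n → ℝ} (he0 : ∀ i, 0 ≤ e i)
    (hfix : brMap g estar e = e) {i : Fin n} (hi0 : 0 < e i) (hi1 : e i < estar) :
    ∃ j, g i j = 1 ∧ 0 < e j ∧ e j < estar := by
  have hg : ∀ i j, 0 ≤ g i j := fun i j => by rcases hg01 i j with h | h <;> simp [h]
  have hi : max 0 (estar - ∑ j, g i j * e j) = e i := congrFun hfix i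
  have hsum : estar - ∑ j, g i j * e j = e i := by
    rcases max_choice 0 (estar - ∑ j, g i j * e j) with h | h <;> linarith
  obtain ⟨j, -, hj⟩ : ∃ j ∈ Finset.univ, 0 < g i j * e j := by
    by_contra! h
    linarith [Finset.sum_nonpos h]
  have hle : g i j * e j ≤ ∑ k, g i k * e k :=
    Finset.single_le_sum (f := fun k => g i k * e k)
      (fun k _ => mul_nonneg (hg i k) (he0 k)) (Finset.mem_univ j)
  rcases hg01 i j with h | h
  · simp [h] at hj
  · rw [h, one_mul] at hj hle
    exact ⟨j, h, hj, by linarith⟩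

/-- Raising the effort of one neighbor by at least `δ`, and no effort lower, raises the weighted
sum of efforts by at least `δ`. -/
theorem sum_add_le_sum {n : ℕ} {w x y : Fin n → ℝ} (hw : ∀ j, 0 ≤ w j) (hxy : x ≤ y)
    {δ : ℝ} {j : Fin n} (hj : w j = 1) (hδ : x j + δ ≤ y j) :
    ∑ k, w k * x k + δ ≤ ∑ k, w k * y k := by
  have h := Finset.single_le_sum (f := fun k => w k * (y k - x k))
    (fun k _ => mul_nonneg (hw k) (sub_nonneg.2 (hxy k))) (Finset.mem_univ j)
  simp only [mul_sub, Finset.sum_sub_distrib, hj, one_mul] at h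
  linarith

/-- If every interior player's effort is at least `δ` above equilibrium and no effort is below it,
the same holds after two rounds of best responses. -/
theorem brMap_brMap_above {n : ℕ} {g : Fin n → Fin n → ℝ}
    (hg01 : ∀ i j, g i j = 0 ∨ g i j = 1) {estar : ℝ} {e : Fin n → ℝ} (he0 : ∀ i, 0 ≤ e i)
    (hfix : brMap g estar e = e) {δ : ℝ} (hδ : ∀ i, 0 < e i → δ ≤ e i) {x : Fin n → ℝ}
    (hx : e ≤ x) (hxδ : ∀ i, 0 < e i → e i < estar → e i + δ ≤ x i) :
    e ≤ brMap g estar (brMap g estar x) ∧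
      ∀ i, 0 < e i → e i < estar → e i + δ ≤ brMap g estar (brMap g estar x) i := by
  have hg : ∀ i j, 0 ≤ g i j := fun i j => by rcases hg01 i j with h | h <;> simp [h]
  have hanti := brMap_antitone hg estar
  have hy : brMap g estar x ≤ e := (hanti hx).trans_eq hfix
  have hsum : ∀ i, 0 < e i → estar - ∑ j, g i j * e j = e i := fun i hi0 => by
    have hi : max 0 (estar - ∑ j, g i j * e j) = e i := congrFun hfix i
    rcases max_choice 0 (estar - ∑ j, g i j * e j) with h | h <;> linarith
  have hyδ : ∀ i, 0 < e i → e i < estar → brMap g estar x i + δ ≤ e i := by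
    intro i hi0 hi1
    obtain ⟨j, hj, hj0, hj1⟩ := exists_interior_neighbor hg01 he0 hfix hi0 hi1
    have h := sum_add_le_sum (hg i) hx hj (hxδ j hj0 hj1)
    have : brMap g estar x i ≤ e i - δ :=
      max_le (by linarith [hδ i hi0]) (by linarith [hsum i hi0])
    linarith
  refine ⟨hfix.symm.trans_le (hanti hy), fun i hi0 hi1 => ?_⟩
  obtain ⟨j, hj, hj0, hj1⟩ := exists_interior_neighbor hg01 he0 hfix hi0 hi1
  have h := sum_add_le_sum (hg i) hy hj (hyδ j hj0 hj1)
  exact le_trans (by linarith [hsum i hi0]) (le_max_right _ _)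

/-- Any Nash equilibrium (fixed point of the best-response map)
that is not specialized, i.e. with some coordinate outside `{0, e*}`, is unstable:
for every `ρ > 0` there is a legitimate perturbation `ε` of size at most `ρ` such
that the best-response iterates from `e + ε` fail to converge back to `e`. -/
theorem nonspecialized_equilibrium_unstable
    {n : ℕ} (g : Fin n → Fin n → ℝ)
    (hg01 : ∀ i j, g i j = 0 ∨ g i j = 1) (hgdiag : ∀ i, g i i = 0)
    (estar : ℝ) (hestar : 0 < estar)
    (e : Fin n → ℝ) (he0 : ∀ i, 0 ≤ e i)
    (hfix : brMap g estar e = e)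
    (hnonspec : ∃ i, e i ≠ 0 ∧ e i ≠ estar) :
    ∀ ρ > (0 : ℝ), ∃ ε : Fin n → ℝ,
      (∀ i, |ε i| ≤ ρ) ∧ (∀ i, 0 ≤ e i + ε i) ∧
      ¬ Filter.Tendsto (fun r : ℕ => (brMap g estar)^[r] (fun i => e i + ε i))
          Filter.atTop (nhds e) := by
  obtain ⟨i, hi0, hi1⟩ := hnonspec
  have hg : ∀ i j, 0 ≤ g i j := fun i j => by rcases hg01 i j with h | h <;> simp [h]
  have hi0 : 0 < e i := lt_of_le_of_ne (he0 i) hi0.symm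
  have hi1 : e i < estar := by
    refine lt_of_le_of_ne ?_ hi1
    rw [← congrFun hfix i]
    exact max_le hestar.le
      (sub_le_self _ (Finset.sum_nonneg fun j _ => mul_nonneg (hg i j) (he0 j)))
  intro ρ hρ
  obtain ⟨δ, hδ, hδρ, hδ0⟩ : ∃ δ : ℝ, (∀ i, 0 < e i → δ ≤ e i) ∧ δ ≤ ρ ∧ 0 < δ := by
    have h : ∀ᶠ δ : ℝ in nhdsWithin 0 (Set.Ioi 0), ∀ i, 0 < e i → δ ≤ e i :=
      Filter.eventually_all.2 fun i => by
        by_cases hi : 0 < e i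
        · filter_upwards [nhdsWithin_le_nhds (Iic_mem_nhds hi)] with δ h _ using h
        · simp [hi]
    have h' : ∀ᶠ δ : ℝ in nhdsWithin 0 (Set.Ioi 0), δ ≤ ρ :=
      nhdsWithin_le_nhds (Iic_mem_nhds hρ)
    exact (h.and (h'.and self_mem_nhdsWithin)).exists
  refine ⟨fun _ => δ, fun _ => by rwa [abs_of_pos hδ0], fun j => by linarith [he0 j],
    fun htend => ?_⟩
  have key : ∀ r : ℕ, e ≤ ((brMap g estar)^[2 * r] fun i => e i + δ) ∧
      ∀ i, 0 < e i → e i < estar → e i + δ ≤ ((brMap g estar)^[2 * r] fun i => e i + δ) i := by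
    intro r
    induction r with
    | zero => exact ⟨fun j => le_add_of_nonneg_right hδ0.le, fun _ _ _ => le_rfl⟩
    | succ r ih =>
      rw [Nat.mul_succ, Function.iterate_succ_apply', Function.iterate_succ_apply']
      exact brMap_brMap_above hg01 he0 hfix hδ ih.1 ih.2
  have hlim := (tendsto_pi_nhds.1 htend i).comp
    (Filter.tendsto_id.const_mul_atTop' (r := 2) (by norm_num : 0 < 2))
  have := ge_of_tendsto' hlim fun r => (key r).2 i hi0 hi1
  linarith
end

section
/- Let G be a digraph on N, let e* > 0, and let e be a specialized equilibrium whose specialist set K is a kernel of order 2, meaning that every i ∈ N∖K has at least two distinct out-neighbors in K. Then e is a stable equilibrium of the public goods game on G: there exists ρ > 0 such that for every perturbation ε with |ε_i| ≤ ρ and e_i + ε_i ≥ 0 for all i, the best-response iterates starting from e + ε converge to e. -/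
/-- Against a nonnegative profile, a vertex with two distinct out-neighbors each contributing at
least half the threshold best responds with `0`. -/
lemma brMap_eq_zero_of_two_outNeighbors {n : ℕ} {g : Fin n → Fin n → ℝ}
    (hg : ∀ i j, 0 ≤ g i j) {estar : ℝ} {x : Fin n → ℝ} (hx : ∀ i, 0 ≤ x i) {i j₁ j₂ : Fin n}
    (hne : j₁ ≠ j₂) (hj₁ : g i j₁ = 1) (hj₂ : g i j₂ = 1)
    (hx₁ : estar / 2 ≤ x j₁) (hx₂ : estar / 2 ≤ x j₂) :
    brMap g estar x i = 0 := by
  have hpair : ∑ j ∈ {j₁, j₂}, g i j * x j ≤ ∑ j, g i j * x j :=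
    Finset.sum_le_sum_of_subset_of_nonneg (Finset.subset_univ _)
      fun j _ _ => mul_nonneg (hg i j) (hx j)
  rw [Finset.sum_pair hne, hj₁, hj₂] at hpair
  exact max_eq_left (by linarith)

/-- A vertex none of whose out-neighbors contributes best responds with the threshold. -/
lemma brMap_eq_of_forall_mul_eq_zero {n : ℕ} {g : Fin n → Fin n → ℝ} {estar : ℝ}
    (hestar : 0 ≤ estar) {x : Fin n → ℝ} {i : Fin n} (h : ∀ j, g i j * x j = 0) :
    brMap g estar x i = estar := by
  simp [brMap, h, hestar]

/-- If every out-neighbor contributes at most `ρ`, the best response is at least `e* - n ρ`. -/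
lemma sub_mul_le_brMap {n : ℕ} {g : Fin n → Fin n → ℝ} {estar ρ : ℝ} {x : Fin n → ℝ} {i : Fin n}
    (h : ∀ j, g i j * x j ≤ ρ) : estar - n * ρ ≤ brMap g estar x i := by
  have hsum : ∑ j, g i j * x j ≤ n * ρ := by
    simpa using Finset.sum_le_sum fun j (_ : j ∈ Finset.univ) => h j
  exact le_max_of_le_right (by linarith)


/-- If the specialist set `K` of a specialized equilibrium `e`
is a kernel of order 2—every vertex outside `K` has at least two distinct
out-neighbors in `K`—then `e` is stable: there is `ρ > 0` such that the
best-response iterates from any legitimate perturbation of `e` of size at most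
`ρ` converge back to `e`. -/
theorem order_two_kernel_equilibrium_stable
    {n : ℕ} (g : Fin n → Fin n → ℝ)
    (hg01 : ∀ i j, g i j = 0 ∨ g i j = 1) (hgdiag : ∀ i, g i i = 0)
    (estar : ℝ) (hestar : 0 < estar)
    (K : Set (Fin n)) (hK : IsKernel g K)
    (horder2 : ∀ i ∉ K, ∃ j₁ ∈ K, ∃ j₂ ∈ K, j₁ ≠ j₂ ∧ g i j₁ = 1 ∧ g i j₂ = 1)
    (e : Fin n → ℝ)
    (heK : ∀ i ∈ K, e i = estar) (heKc : ∀ i ∉ K, e i = 0) :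
    ∃ ρ > (0 : ℝ), ∀ ε : Fin n → ℝ,
      (∀ i, |ε i| ≤ ρ) → (∀ i, 0 ≤ e i + ε i) →
      Filter.Tendsto (fun r : ℕ => (brMap g estar)^[r] (fun i => e i + ε i))
        Filter.atTop (nhds e) := by
  have hg0 : ∀ i j, 0 ≤ g i j := fun i j => by rcases hg01 i j with h | h <;> simp [h]
  have off_kernel : ∀ x : Fin n → ℝ, (∀ i, 0 ≤ x i) → (∀ i ∈ K, estar / 2 ≤ x i) →
      ∀ i ∉ K, brMap g estar x i = 0 := by
    intro x hx hxK i hi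
    obtain ⟨j₁, hj₁, j₂, hj₂, hne, h₁, h₂⟩ := horder2 i hi
    exact brMap_eq_zero_of_two_outNeighbors hg0 hx hne h₁ h₂ (hxK j₁ hj₁) (hxK j₂ hj₂)
  have brMap_eq : ∀ x : Fin n → ℝ, (∀ i, 0 ≤ x i) → (∀ i ∈ K, estar / 2 ≤ x i) →
      (∀ i ∉ K, x i = 0) → brMap g estar x = e := by
    intro x hx hxK hxKc
    funext i
    by_cases hi : i ∈ K
    · rw [heK i hi]
      refine brMap_eq_of_forall_mul_eq_zero hestar.le fun j => ?_
      by_cases hj : j ∈ K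
      · simp [hK.1 i hi j hj]
      · simp [hxKc j hj]
    · rw [heKc i hi, off_kernel x hx hxK i hi]
  have fixed : Function.IsFixedPt (brMap g estar) e := by
    refine brMap_eq e (fun i => ?_) (fun i hi => ?_) heKc
    · by_cases hi : i ∈ K
      · exact (heK i hi).symm ▸ hestar.le
      · exact (heKc i hi).ge
    · rw [heK i hi]; linarith
  set ρ : ℝ := estar / (2 * (n + 1)) with hρ
  have hρ0 : 0 < ρ := by positivity
  have hρmul : (n + 1) * ρ = estar / 2 := by rw [hρ]; field_simp
  have hnρ : 0 ≤ n * ρ := by positivity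
  refine ⟨ρ, hρ0, fun ε hε hpos => ?_⟩
  have two_steps : brMap g estar (brMap g estar fun i => e i + ε i) = e := by
    refine brMap_eq _ (fun i => le_max_left _ _) (fun i hi => ?_)
      (off_kernel _ hpos fun i hi => ?_)
    · refine (show estar / 2 ≤ estar - n * ρ by linarith).trans (sub_mul_le_brMap fun j => ?_)
      by_cases hj : j ∈ K
      · simpa [hK.1 i hi j hj] using hρ0.le
      · rcases hg01 i j with h | h
        · simpa [h] using hρ0.le
        · simpa [h, heKc j hj] using (abs_le.mp (hε j)).2
    · have := (abs_le.mp (hε i)).1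
      rw [heK i hi]
      linarith
  refine tendsto_const_nhds.congr' ?_
  filter_upwards [Filter.eventually_ge_atTop 2] with r hr
  obtain ⟨m, rfl⟩ := Nat.exists_eq_add_of_le' hr
  rw [Function.iterate_add_apply]
  exact ((congrArg _ two_steps).trans (fixed.iterate m)).symm
end

section
/- Let G be a finite acyclic digraph on N and let e* > 0. Then the (unique) specialized equilibrium of the public goods game on G is stable: there exists ρ > 0 such that for every perturbation ε with |ε_i| ≤ ρ and e_i + ε_i ≥ 0 for all i, the best-response iterates starting from e + ε converge to e. -/
/-- A self-map of a nonempty finite type has a periodic point. -/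
theorem exists_mem_periodicPts {α : Type*} [Finite α] [Nonempty α] (s : α → α) :
    ∃ x, x ∈ Function.periodicPts s := by
  obtain ⟨x⟩ := ‹Nonempty α›
  obtain ⟨a, b, hab, h⟩ := Finite.exists_ne_map_eq_of_infinite fun m : ℕ => s^[m] x
  wlog hlt : a < b generalizing a b
  · exact this b a hab.symm h.symm (by omega)
  refine ⟨s^[a] x, b - a, by omega, ?_⟩
  change s^[b - a] (s^[a] x) = s^[a] x
  rw [← Function.iterate_add_apply, Nat.sub_add_cancel hlt.le]
  exact h.symm

/-- A nonempty vertex set in which every vertex has a successor contains a directed cycle. -/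
theorem exists_isDirCycle_of_forall_exists_mem {n : ℕ} {g : Fin n → Fin n → ℝ} {B : Set (Fin n)}
    (hB : B.Nonempty) (hsucc : ∀ i ∈ B, ∃ j ∈ B, g i j = 1) :
    ∃ (k : ℕ) (v : Fin k → Fin n), IsDirCycle g k v := by
  have hs : ∀ i : B, ∃ j : B, g i j = 1 := fun i => by
    obtain ⟨j, hj, h⟩ := hsucc i i.2
    exact ⟨⟨j, hj⟩, h⟩
  choose s hs using hs
  have := hB.to_subtype
  obtain ⟨x, hx⟩ := exists_mem_periodicPts s
  refine ⟨Function.minimalPeriod s x, fun t => (s^[t.1] x : B),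
    Function.minimalPeriod_pos_of_mem_periodicPts hx, ?_, fun t => ?_⟩
  · intro a b hab
    exact Fin.ext (Function.iterate_injOn_Iio_minimalPeriod a.2 b.2 (Subtype.ext hab))
  · simp only [Function.iterate_mod_minimalPeriod_eq, Function.iterate_succ_apply']
    exact hs _

/-- A specialized equilibrium is a fixed point of the best-response map. -/
theorem IsSpecEq.brMap_eq {n : ℕ} {g : Fin n → Fin n → ℝ}
    (hg01 : ∀ i j, g i j = 0 ∨ g i j = 1) {estar : ℝ} (hestar : 0 < estar)
    {e : Fin n → ℝ} (he : IsSpecEq g estar e) : brMap g estar e = e := by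
  have hval : ∀ j, e j = 0 ∨ e j = estar := fun j =>
    (le_or_gt estar (∑ l, g j l * e l)).imp (he j).1 (he j).2
  have hterm : ∀ i j, g i j * e j = 0 ∨ g i j * e j = estar := fun i j => by
    rcases hg01 i j with h | h <;> rcases hval j with h' | h' <;> simp [h, h']
  have hnonneg : ∀ i j, 0 ≤ g i j * e j := fun i j => by
    rcases hterm i j with h | h <;> rw [h]
    exact hestar.le
  funext i
  rcases le_or_gt estar (∑ j, g i j * e j) with h | h
  · rw [(he i).1 h]
    exact max_eq_left (sub_nonpos.2 h)
  · have hzero : ∑ j, g i j * e j = 0 := Finset.sum_eq_zero fun j _ =>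
      (hterm i j).resolve_right fun hj => by
        have := Finset.single_le_sum (fun l _ => hnonneg i l) (Finset.mem_univ j)
        linarith
    rw [(he i).2 h, brMap, hzero, sub_zero, max_eq_right hestar.le]

/-- On an acyclic digraph, every best-response orbit reaches any given fixed point of the
best-response map in finitely many steps. -/
theorem eventually_iterate_brMap_eq {n : ℕ} {g : Fin n → Fin n → ℝ}
    (hg01 : ∀ i j, g i j = 0 ∨ g i j = 1)
    (hacyclic : ∀ (k : ℕ) (v : Fin k → Fin n), ¬ IsDirCycle g k v)
    {estar : ℝ} {e : Fin n → ℝ} (he : brMap g estar e = e) (x : Fin n → ℝ) :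
    ∀ᶠ r in Filter.atTop, (brMap g estar)^[r] x = e := by
  suffices h : ∀ i, ∀ᶠ r in Filter.atTop, (brMap g estar)^[r] x i = e i from
    (Filter.eventually_all.2 h).mono fun r hr => funext hr
  by_contra hne
  obtain ⟨k, v, hv⟩ := exists_isDirCycle_of_forall_exists_mem (g := g)
    (B := {i | ¬ ∀ᶠ r in Filter.atTop, (brMap g estar)^[r] x i = e i}) (not_forall.1 hne) (by
      intro i hi
      by_contra hsucc
      apply hi
      have hout : ∀ j, ∀ᶠ r in Filter.atTop, g i j * (brMap g estar)^[r] x j = g i j * e j := by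
        intro j
        rcases hg01 i j with h | h
        · simp [h]
        · have hj : ∀ᶠ r in Filter.atTop, (brMap g estar)^[r] x j = e j :=
            not_not.1 fun hj => hsucc ⟨j, hj, h⟩
          exact hj.mono fun r hr => by rw [hr]
      obtain ⟨R, hR⟩ := Filter.eventually_atTop.1 (Filter.eventually_all.2 hout)
      refine Filter.eventually_atTop.2 ⟨R + 1, fun r hr => ?_⟩
      obtain ⟨m, rfl⟩ : ∃ m, r = m + 1 := ⟨r - 1, by omega⟩
      rw [Function.iterate_succ_apply', ← congrFun he i]
      simp only [brMap]
      rw [Finset.sum_congr rfl fun j _ => hR m (by omega) j])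
  exact hacyclic k v hv


/-- On a finite acyclic digraph, the (unique) specialized
equilibrium of the public goods game is stable: there is `ρ > 0` such that the
best-response iterates from any legitimate perturbation of `e` of size at most `ρ`
converge back to `e`. -/
theorem acyclic_specialized_equilibrium_stable
    {n : ℕ} (g : Fin n → Fin n → ℝ)
    (hg01 : ∀ i j, g i j = 0 ∨ g i j = 1) (hgdiag : ∀ i, g i i = 0)
    (hacyclic : ∀ (k : ℕ) (v : Fin k → Fin n), ¬ IsDirCycle g k v)
    (estar : ℝ) (hestar : 0 < estar)
    (e : Fin n → ℝ) (he : IsSpecEq g estar e) :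
    ∃ ρ > (0 : ℝ), ∀ ε : Fin n → ℝ,
      (∀ i, |ε i| ≤ ρ) → (∀ i, 0 ≤ e i + ε i) →
      Filter.Tendsto (fun r : ℕ => (brMap g estar)^[r] (fun i => e i + ε i))
        Filter.atTop (nhds e) := by
  refine ⟨1, one_pos, fun ε _ _ => tendsto_const_nhds.congr' ?_⟩
  exact (eventually_iterate_brMap_eq hg01 hacyclic (he.brMap_eq hg01 hestar) _).mono
    fun r hr => hr.symm
end
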